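/- arXiv:2110.12920 — 2 statements merged into one kernel-verified Lean document; each statement's English description precedes it below -/
import Mathlib

section
/- Let (X, ρ, μ) be a metric measure space and suppose BMO^{p₁}(X) ⊊ BMO^{p₂}(X) fails, i.e., there exists a real-valued f ∈ BMO^{p₁}(X) \ BMO^{p₂}(X), for some 1 ≤ p₁ < p₂ < ∞. Then for every α ∈ (1, ∞) there exists g ∈ BMO^{αp₁}(X) \ BMO^{αp₂}(X); that is, BMO^{αp₂}(X) is a proper subset of BMO^{αp₁}(X). -/
open MeasureTheory
open scoped ENNReal

/-- The `BMO^p` seminorm of a function `f`, defined as the supremum over all open balls of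
finite positive measure of the normalized `p`-th mean oscillation (raised to power `1/p`). -/
noncomputable def bmoSeminorm {X : Type*} [MetricSpace X] [MeasurableSpace X]
    (μ : Measure X) (p : ℝ) (f : X → ℝ) : ℝ≥0∞ :=
  ⨆ (z : X) (s : ℝ) (_ : 0 < μ (Metric.ball z s)) (_ : μ (Metric.ball z s) < ⊤),
    ((μ (Metric.ball z s))⁻¹ *
      ∫⁻ x in Metric.ball z s,
        ENNReal.ofReal (|f x - ⨍ y in Metric.ball z s, f y ∂μ| ^ p) ∂μ) ^ (1 / p)

/-- `G` vanishes at `0`, and is both `r`-Lipschitz and `β`-Hölder with constant `r`. -/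
def HolLip (β r : ℝ) (G : ℝ → ℝ) : Prop :=
  G 0 = 0 ∧ ∀ a b, |G a - G b| ≤ r * |a - b| ∧ |G a - G b| ≤ r * |a - b| ^ β

/-- mean oscillation -/
noncomputable def oscAux {X : Type*} [MeasurableSpace X] (ν : Measure X) (q : ℝ) (u : X → ℝ) :
    ℝ≥0∞ := eLpNorm (fun x => u x - ∫ y, u y ∂ν) (ENNReal.ofReal q) ν

lemma HolLip.add {β r s : ℝ} {G H : ℝ → ℝ} (hG : HolLip β r G) (hH : HolLip β s H) :
    HolLip β (r + s) (G + H) := by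
  refine ⟨by simp [hG.1, hH.1], fun a b => ?_⟩
  have e : (G + H) a - (G + H) b = (G a - G b) + (H a - H b) := by simp; ring
  rw [e]
  have := abs_add_le (G a - G b) (H a - H b)
  have h1 := hG.2 a b
  have h2 := hH.2 a b
  constructor <;> rw [add_mul] <;> linarith

lemma HolLip.smul {β r : ℝ} {G : ℝ → ℝ} (hG : HolLip β r G) (c : ℝ) :
    HolLip β (|c| * r) (fun t => c * G t) := by
  refine ⟨by simp [hG.1], fun a b => ?_⟩
  have h1 := hG.2 a b
  rw [← mul_sub, abs_mul]
  constructor <;> rw [mul_assoc]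
  · exact mul_le_mul_of_nonneg_left h1.1 (abs_nonneg c)
  · exact mul_le_mul_of_nonneg_left h1.2 (abs_nonneg c)

lemma HolLip.nonneg {β r : ℝ} {G : ℝ → ℝ} (hG : HolLip β r G) : 0 ≤ r := by
  have := (hG.2 1 0).1
  simp at this
  exact (abs_nonneg _).trans this

lemma HolLip.continuous {β r : ℝ} {G : ℝ → ℝ} (hG : HolLip β r G) : Continuous G := by
  have : LipschitzWith ⟨r, hG.nonneg⟩ G := LipschitzWith.of_dist_le_mul (fun a b => by
    rw [Real.dist_eq, Real.dist_eq]
    exact (hG.2 a b).1)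
  exact this.continuous

lemma HolLip.integrable {X : Type*} [MeasurableSpace X] {ν : Measure X} {β r : ℝ} {G : ℝ → ℝ}
    (hG : HolLip β r G) {f : X → ℝ} (hf : Integrable f ν) : Integrable (fun x => G (f x)) ν := by
  refine Integrable.mono' (hf.abs.const_mul r)
    (hG.continuous.comp_aestronglyMeasurable hf.aestronglyMeasurable) (Filter.Eventually.of_forall
      fun x => ?_)
  have := (hG.2 (f x) 0).1
  simpa [hG.1] using this

/-- basic power function facts -/
lemma psi_aux {β : ℝ} (h0 : 0 < β) (h1 : β < 1) {s t : ℝ} (ht : 0 ≤ t) (hts : t ≤ s) :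
    |(1 + s) ^ β - (1 + t) ^ β| ≤ s - t ∧ |(1 + s) ^ β - (1 + t) ^ β| ≤ (s - t) ^ β := by
  have hm : (1 + t) ^ β ≤ (1 + s) ^ β := Real.rpow_le_rpow (by linarith) (by linarith) h0.le
  rw [abs_of_nonneg (by linarith)]
  constructor
  · have hq : 1 ≤ (1 + s) / (1 + t) := by rw [le_div_iff₀ (by linarith)]; linarith
    have e : (1 + s) ^ β = (1 + t) ^ β * ((1 + s) / (1 + t)) ^ β := by
      rw [← Real.mul_rpow (by linarith) (by linarith)]
      congr 1
      field_simp
    have a1 : ((1 + s) / (1 + t)) ^ β ≤ (1 + s) / (1 + t) := by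
      simpa using Real.rpow_le_rpow_of_exponent_le hq h1.le
    have a2 : (1 + t) ^ β ≤ 1 + t := by
      simpa using Real.rpow_le_rpow_of_exponent_le (show 1 ≤ 1 + t by linarith) h1.le
    have a3 : 0 ≤ (1 + t) ^ β := Real.rpow_nonneg (by linarith) _
    calc (1 + s) ^ β - (1 + t) ^ β = (1 + t) ^ β * (((1 + s) / (1 + t)) ^ β - 1) := by rw [e]; ring
      _ ≤ (1 + t) ^ β * ((1 + s) / (1 + t) - 1) := by gcongr
      _ ≤ (1 + t) * ((1 + s) / (1 + t) - 1) := by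
        apply mul_le_mul_of_nonneg_right a2; linarith
      _ = s - t := by field_simp; ring
  · have := Real.rpow_add_le_add_rpow (p := β) (a := 1 + t) (b := s - t) (by linarith) (by linarith)
      h0.le h1.le
    have e : 1 + t + (s - t) = 1 + s := by ring
    rw [e] at this
    linarith

lemma psi_holLip {β : ℝ} (h0 : 0 < β) (h1 : β < 1) (c : ℝ) :
    HolLip β 1 (fun t => (1 + |t - c|) ^ β - (1 + |0 - c|) ^ β) := by
  refine ⟨by simp, fun a b => ?_⟩
  have key : ∀ a b : ℝ, |b| ≤ |a| → |(1 + |a|) ^ β - (1 + |b|) ^ β| ≤ |a - b| ∧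
      |(1 + |a|) ^ β - (1 + |b|) ^ β| ≤ |a - b| ^ β := by
    intro a b hab
    have := psi_aux h0 h1 (abs_nonneg b) hab
    have h2 := abs_sub_abs_le_abs_sub a b
    exact ⟨this.1.trans h2, this.2.trans (Real.rpow_le_rpow (by linarith) h2 h0.le)⟩
  have e : (1 + |a - c|) ^ β - (1 + |0 - c|) ^ β - ((1 + |b - c|) ^ β - (1 + |0 - c|) ^ β)
    = (1 + |a - c|) ^ β - (1 + |b - c|) ^ β := by ring
  simp only [e, one_mul]
  rcases le_total |b - c| |a - c| with h | h
  · simpa using key _ _ h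
  · have := key _ _ h
    rw [abs_sub_comm, abs_sub_comm a b]
    simpa using this

section prob

variable {X : Type*} [MeasurableSpace X] {ν : Measure X} [IsProbabilityMeasure ν]

lemma eLpNorm_const_prob (q : ℝ) (hq : 1 ≤ q) (c : ℝ) :
    eLpNorm (fun _ : X => c) (ENNReal.ofReal q) ν = ‖c‖ₑ := by
  rw [eLpNorm_const _ (by simp; linarith) (IsProbabilityMeasure.ne_zero ν)]
  simp

lemma enorm_int_le {q : ℝ} (hq : 1 ≤ q) {u : X → ℝ} (hu : AEStronglyMeasurable u ν) :
    ‖∫ x, u x ∂ν‖ₑ ≤ eLpNorm u (ENNReal.ofReal q) ν := by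
  refine (enorm_integral_le_lintegral_enorm u).trans ?_
  rw [← eLpNorm_one_eq_lintegral_enorm]
  exact eLpNorm_le_eLpNorm_of_exponent_le (by simpa using hq) hu

lemma osc_le_two {q : ℝ} (hq : 1 ≤ q) {u : X → ℝ} (hu : Integrable u ν) (d : ℝ) :
    oscAux ν q u ≤ 2 * eLpNorm (fun x => u x - d) (ENNReal.ofReal q) ν := by
  have hm : AEStronglyMeasurable (fun x => u x - d) ν :=
    hu.aestronglyMeasurable.sub aestronglyMeasurable_const
  have e : (fun x => u x - ∫ y, u y ∂ν) = (fun x => u x - d) - (fun _ => ∫ y, (u y - d) ∂ν) := by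
    ext x
    simp only [Pi.sub_apply]
    rw [integral_sub hu (integrable_const d)]
    simp
  unfold oscAux
  rw [e]
  refine (eLpNorm_sub_le hm aestronglyMeasurable_const (by simpa using hq)).trans ?_
  rw [eLpNorm_const_prob q hq, two_mul]
  gcongr
  exact enorm_int_le hq hm

lemma pow_norm {α p : ℝ} (hα : 1 < α) (f : X → ℝ) :
    eLpNorm (fun x => |f x| ^ (1 / α)) (ENNReal.ofReal (α * p)) ν
      = eLpNorm f (ENNReal.ofReal p) ν ^ (1 / α) := by
  have hα0 : 0 < α := by linarith
  have := eLpNorm_norm_rpow (p := ENNReal.ofReal (α * p)) (q := 1 / α) (μ := ν) f (by positivity)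
  simp only [Real.norm_eq_abs] at this
  rw [this, ← ENNReal.ofReal_mul' (by positivity)]
  congr 3
  field_simp

lemma osc_upper {α p r : ℝ} (hα : 1 < α) (hp : 1 ≤ p) {f : X → ℝ} (hf : Integrable f ν)
    {G : ℝ → ℝ} (hG : HolLip (1 / α) r G) :
    oscAux ν (α * p) (fun x => G (f x)) ≤ 2 * (ENNReal.ofReal r * oscAux ν p f ^ (1 / α)) := by
  have hq : 1 ≤ α * p := by nlinarith
  refine (osc_le_two hq (hG.integrable hf) (G (∫ y, f y ∂ν))).trans ?_
  gcongr
  unfold oscAux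
  rw [← pow_norm hα]
  refine eLpNorm_le_mul_eLpNorm_of_ae_le_mul (Filter.Eventually.of_forall fun x => ?_) _
  have := (hG.2 (f x) (∫ y, f y ∂ν)).2
  rw [Real.norm_eq_abs, Real.norm_eq_abs, abs_of_nonneg (Real.rpow_nonneg (abs_nonneg _) _)]
  exact this

lemma osc_sub {q : ℝ} (hq : 1 ≤ q) {u v : X → ℝ} (hu : Integrable u ν) (hv : Integrable v ν) :
    oscAux ν q (fun x => u x - v x) ≤ oscAux ν q u + oscAux ν q v := by
  unfold oscAux
  rw [integral_sub hu hv]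
  have e : (fun x => u x - v x - (∫ y, u y ∂ν - ∫ y, v y ∂ν)) =
      (fun x => u x - ∫ y, u y ∂ν) - (fun x => v x - ∫ y, v y ∂ν) := by
    ext x; simp; ring
  rw [e]
  exact eLpNorm_sub_le (hu.aestronglyMeasurable.sub aestronglyMeasurable_const)
    (hv.aestronglyMeasurable.sub aestronglyMeasurable_const) (by simpa using hq)

lemma osc_smul (q c : ℝ) (u : X → ℝ) :
    oscAux ν q (fun x => c * u x) = ‖c‖ₑ * oscAux ν q u := by
  unfold oscAux
  rw [integral_const_mul, ← eLpNorm_const_smul]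
  congr 1
  ext x
  simp; ring

lemma osc_lower {α p p' : ℝ} (hα : 1 < α) (hp : 1 ≤ p) (hp' : 1 ≤ p') {f : X → ℝ}
    (hf : Integrable f ν) :
    oscAux ν p f ^ (1 / α) ≤ oscAux ν (α * p)
      (fun x => (1 + |f x - ∫ y, f y ∂ν|) ^ (1 / α) - (1 + |0 - ∫ y, f y ∂ν|) ^ (1 / α))
      + (1 + oscAux ν p' f) := by
  have hq : 1 ≤ α * p := by nlinarith
  have hβ0 : 0 < 1 / α := by positivity
  have hβ1 : 1 / α < 1 := by rw [div_lt_one (by linarith)]; exact hα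
  set c := ∫ y, f y ∂ν with hc
  have hGi := (psi_holLip hβ0 hβ1 c).integrable hf
  set w : X → ℝ := fun x => (1 + |f x - c|) ^ (1 / α) with hw
  set d : ℝ := (1 + |0 - c|) ^ (1 / α) with hd
  have hwi : Integrable w ν := by
    have := hGi.add (integrable_const d)
    refine this.congr (Filter.Eventually.of_forall fun x => ?_)
    simp [hw, hd]
  have hfc : Integrable (fun x => f x - c) ν := hf.sub (integrable_const c)
  have h1 : oscAux ν p f ^ (1 / α) ≤ eLpNorm w (ENNReal.ofReal (α * p)) ν := by
    unfold oscAux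
    rw [← pow_norm hα]
    refine eLpNorm_mono_real fun x => ?_
    rw [Real.norm_eq_abs, abs_of_nonneg (Real.rpow_nonneg (abs_nonneg _) _)]
    exact Real.rpow_le_rpow (abs_nonneg _) (by linarith) hβ0.le
  refine h1.trans ?_
  have e : w = (fun x => (w x - d) - ∫ y, (w y - d) ∂ν) + (fun _ => ∫ y, w y ∂ν) := by
    ext x
    simp only [Pi.add_apply]
    rw [integral_sub hwi (integrable_const d)]
    simp
  have h2 : eLpNorm w (ENNReal.ofReal (α * p)) ν ≤
      oscAux ν (α * p) (fun x => w x - d) + ‖∫ y, w y ∂ν‖ₑ := by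
    conv_lhs => rw [e]
    refine (eLpNorm_add_le ?_ aestronglyMeasurable_const (by simpa using hq)).trans ?_
    · exact (hwi.sub (integrable_const d)).aestronglyMeasurable.sub aestronglyMeasurable_const
    · rw [eLpNorm_const_prob _ hq]
      rfl
  refine h2.trans ?_
  gcongr
  have h3 : ‖∫ y, w y ∂ν‖ₑ ≤ eLpNorm w (ENNReal.ofReal p') ν :=
    enorm_int_le hp' hwi.aestronglyMeasurable
  refine h3.trans ?_
  have h4 : eLpNorm w (ENNReal.ofReal p') ν ≤
      eLpNorm ((fun _ => (1 : ℝ)) + (fun x => ‖f x - c‖)) (ENNReal.ofReal p') ν := by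
    refine eLpNorm_mono_real fun x => ?_
    have h0 : 0 ≤ |f x - c| := abs_nonneg _
    rw [Real.norm_eq_abs, abs_of_nonneg (Real.rpow_nonneg (by linarith) _)]
    simpa using Real.rpow_le_rpow_of_exponent_le (show 1 ≤ 1 + |f x - c| by linarith) hβ1.le
  refine h4.trans ?_
  refine (eLpNorm_add_le aestronglyMeasurable_const hfc.norm.aestronglyMeasurable
    (by simpa using hp')).trans ?_
  rw [eLpNorm_const_prob _ hp', eLpNorm_norm]
  simp [oscAux, hc]

lemma step_exists {β q ε : ℝ} (hq : 1 ≤ q) (hε : 0 ≤ ε) {f : X → ℝ} (hf : Integrable f ν)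
    {H : ℝ → ℝ} (hH : HolLip β 1 H) (G : ℝ → ℝ) :
    ∃ G' : ℝ → ℝ, HolLip β ε (fun t => G' t - G t) ∧ ((∃ r, HolLip β r G) →
      ENNReal.ofReal ε * oscAux ν q (fun x => H (f x)) ≤ oscAux ν q (fun x => G' (f x))) := by
  have hp := hH.smul ε
  have hm := hH.smul (-ε)
  rw [abs_neg, abs_of_nonneg hε, mul_one] at hm
  rw [abs_of_nonneg hε, mul_one] at hp
  by_contra! hcon
  obtain ⟨⟨r, hr⟩, c1⟩ := hcon (fun t => G t + ε * H t) (by simpa using hp)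
  obtain ⟨-, c2⟩ := hcon (fun t => G t + -ε * H t) (by simpa using hm)
  have i1 : Integrable (fun x => G (f x) + ε * H (f x)) ν := (hr.add hp).integrable hf
  have i2 : Integrable (fun x => G (f x) + -ε * H (f x)) ν := (hr.add hm).integrable hf
  have h := osc_sub hq i1 i2
  have e : (fun x => G (f x) + ε * H (f x) - (G (f x) + -ε * H (f x))) =
    fun x => (2 * ε) * H (f x) := by ext x; ring
  rw [e, osc_smul (ν := ν) q (2 * ε) (fun x => H (f x)), Real.enorm_of_nonneg (by linarith), ENNReal.ofReal_mul (by norm_num)] at h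
  have := h.trans_lt (ENNReal.add_lt_add c1 c2)
  rw [← two_mul, mul_assoc] at this
  simp at this

end prob

lemma glide {X : Type*} [MeasurableSpace X] (ν : ℕ → Measure X) [∀ n, IsProbabilityMeasure (ν n)]
    {f : X → ℝ} (hf : ∀ n, Integrable f (ν n)) {α p : ℝ} (hα : 1 < α) (hp : 1 ≤ p)
    {H : ℕ → ℝ → ℝ} (hH : ∀ n, HolLip (1 / α) 1 (H n)) :
    ∃ G : ℝ → ℝ, (∃ r, HolLip (1 / α) r G) ∧ ∀ n,
      ENNReal.ofReal ((1 / 9) ^ n) * oscAux (ν n) (α * p) (fun x => H n (f x)) ≤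
        oscAux (ν n) (α * p) (fun x => G (f x)) +
        2 * (ENNReal.ofReal ((1 / 9) ^ n / 8) * oscAux (ν n) p f ^ (1 / α)) := by
  have hq : 1 ≤ α * p := by nlinarith
  have hs := fun n => step_exists (ν := ν n) (β := 1 / α) (q := α * p) (ε := (1 / 9) ^ n) hq
    (by positivity) (hf n) (hH n)
  choose S hS1 hS2 using hs
  let x : ℕ → ℝ → ℝ := fun n => Nat.rec (fun _ => 0) (fun n G => S n G) n
  have x0 : x 0 = fun _ => 0 := rfl
  have xs : ∀ n, x (n + 1) = S n (x n) := fun n => rfl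
  have hd : ∀ n, HolLip (1 / α) ((1 / 9) ^ n) (fun t => x (n + 1) t - x n t) := fun n => by
    rw [xs]; exact hS1 n (x n)
  have hx : ∀ n, ∃ r, HolLip (1 / α) r (x n) := by
    intro n
    induction n with
    | zero => exact ⟨0, by simp [HolLip, x0]⟩
    | succ n ih =>
      obtain ⟨r, hr⟩ := ih
      refine ⟨r + (1 / 9) ^ n, ?_⟩
      have := hr.add (hd n)
      convert this using 1
      ext t; simp
  have hlo := fun n => hS2 n (x n) (hx n)
  have z0 : ∀ n, x n 0 = 0 := fun n => (hx n).choose_spec.1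
  have hdist : ∀ a b n, dist (x n a - x n b) (x (n + 1) a - x (n + 1) b) ≤ |a - b| * (1 / 9) ^ n ∧
      dist (x n a - x n b) (x (n + 1) a - x (n + 1) b) ≤ |a - b| ^ (1 / α) * (1 / 9) ^ n := by
    intro a b n
    have h := (hd n).2 a b
    have e : x (n + 1) a - x n a - (x (n + 1) b - x n b) =
      (x (n + 1) a - x (n + 1) b) - (x n a - x n b) := by ring
    simp only [e] at h
    rw [dist_comm, Real.dist_eq, mul_comm, mul_comm (|a - b| ^ (1 / α))]
    exact h
  have hlim : ∀ a, ∃ l, Filter.Tendsto (fun n => x n a) Filter.atTop (nhds l) := by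
    intro a
    refine cauchySeq_tendsto_of_complete (cauchySeq_of_le_geometric (1 / 9) |a - 0| (by norm_num)
      fun n => ?_)
    simpa [z0] using (hdist a 0 n).1
  choose G hG using hlim
  have hGn : ∀ n, HolLip (1 / α) ((1 / 9) ^ n * (9 / 8)) (fun t => x n t - G t) := by
    intro n
    have g0 : G 0 = 0 := tendsto_nhds_unique (hG 0) (by simp [z0])
    refine ⟨by simp [z0, g0], fun a b => ?_⟩
    have h1 := dist_le_of_le_geometric_of_tendsto (1 / 9) _ (by norm_num)
      (fun n => (hdist a b n).1) ((hG a).sub (hG b)) n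
    have h2 := dist_le_of_le_geometric_of_tendsto (1 / 9) _ (by norm_num)
      (fun n => (hdist a b n).2) ((hG a).sub (hG b)) n
    have e : x n a - G a - (x n b - G b) = x n a - x n b - (G a - G b) := by ring
    rw [Real.dist_eq] at h1 h2
    simp only [e]
    constructor
    · refine h1.trans (le_of_eq ?_); ring
    · refine h2.trans (le_of_eq ?_); ring
  have hGH : HolLip (1 / α) (9 / 8) G := by
    have := (hGn 0).smul (-1)
    simpa [x0] using this
  refine ⟨G, ⟨_, hGH⟩, fun n => (hlo n).trans ?_⟩
  rw [← xs]
  have hh := hGn (n + 1)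
  have e9 : ((1 : ℝ) / 9) ^ (n + 1) * (9 / 8) = (1 / 9) ^ n / 8 := by rw [pow_succ]; ring
  rw [e9] at hh
  refine le_trans ?_ (add_le_add_right (osc_upper hα hp (hf n) hh) _)
  have hm := hh.smul (-1)
  have := osc_sub hq (hGH.integrable (hf n)) (hm.integrable (hf n))
  rw [osc_smul (ν := ν n) (α * p) (-1) (fun y => x (n + 1) (f y) - G (f y))] at this
  simpa using this


/-- normalised restriction to a ball -/
noncomputable def nuB {X : Type*} [MetricSpace X] [MeasurableSpace X] (μ : Measure X)
    (z : X) (s : ℝ) : Measure X :=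
  (μ (Metric.ball z s))⁻¹ • μ.restrict (Metric.ball z s)

lemma nuB_prob {X : Type*} [MetricSpace X] [MeasurableSpace X] {μ : Measure X}
    {z : X} {s : ℝ} (h0 : 0 < μ (Metric.ball z s)) (h1 : μ (Metric.ball z s) < ⊤) :
    IsProbabilityMeasure (nuB μ z s) := by
  constructor
  simp [nuB, ENNReal.inv_mul_cancel h0.ne' h1.ne]

lemma nuB_integrable {X : Type*} [MetricSpace X] [MeasurableSpace X] {μ : Measure X}
    {z : X} {s : ℝ} (h0 : 0 < μ (Metric.ball z s)) {f : X → ℝ}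
    (hf : IntegrableOn f (Metric.ball z s) μ) : Integrable f (nuB μ z s) :=
  Integrable.smul_measure hf (by simpa using h0.ne')

lemma term_eq {X : Type*} [MetricSpace X] [MeasurableSpace X] (μ : Measure X)
    (z : X) (s : ℝ) {p : ℝ} (hp : 1 ≤ p) (f : X → ℝ) :
    ((μ (Metric.ball z s))⁻¹ *
      ∫⁻ x in Metric.ball z s,
        ENNReal.ofReal (|f x - ⨍ y in Metric.ball z s, f y ∂μ| ^ p) ∂μ) ^ (1 / p)
      = oscAux (nuB μ z s) p f := by
  have hp0 : 0 < p := by linarith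
  unfold oscAux
  rw [eLpNorm_eq_lintegral_rpow_enorm_toReal (by simpa using hp0) (by simp),
    ENNReal.toReal_ofReal hp0.le]
  have e : ⨍ y in Metric.ball z s, f y ∂μ = ∫ y, f y ∂(nuB μ z s) := by
    simp [average, nuB]
  rw [e]
  congr 1
  conv_rhs => rw [nuB, lintegral_smul_measure, smul_eq_mul]
  congr 1
  refine lintegral_congr fun x => ?_
  rw [← ENNReal.ofReal_rpow_of_nonneg (abs_nonneg _) hp0.le, ← Real.enorm_eq_ofReal_abs]
  rfl

lemma osc_le_bmo {X : Type*} [MetricSpace X] [MeasurableSpace X] {μ : Measure X}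
    {z : X} {s : ℝ} (h0 : 0 < μ (Metric.ball z s)) (h1 : μ (Metric.ball z s) < ⊤) {p : ℝ}
    (hp : 1 ≤ p) (f : X → ℝ) : oscAux (nuB μ z s) p f ≤ bmoSeminorm μ p f := by
  rw [← term_eq μ z s hp]
  unfold bmoSeminorm
  exact le_iSup_of_le z (le_iSup_of_le s (le_iSup_of_le h0 (le_iSup_of_le h1 le_rfl)))

lemma bmo_le {X : Type*} [MetricSpace X] [MeasurableSpace X] {μ : Measure X} {p : ℝ}
    (hp : 1 ≤ p) (f : X → ℝ) (K : ℝ≥0∞) (h : ∀ z s, 0 < μ (Metric.ball z s) →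
      μ (Metric.ball z s) < ⊤ → oscAux (nuB μ z s) p f ≤ K) : bmoSeminorm μ p f ≤ K := by
  unfold bmoSeminorm
  refine iSup_le fun z => iSup_le fun s => iSup_le fun h0 => iSup_le fun h1 => ?_
  rw [term_eq μ z s hp]
  exact h z s h0 h1

lemma exists_ball {X : Type*} [MetricSpace X] [MeasurableSpace X] {μ : Measure X} {p : ℝ}
    (hp : 1 ≤ p) (f : X → ℝ) (h : bmoSeminorm μ p f = ⊤) (K : ℝ≥0∞) (hK : K < ⊤) :
    ∃ zs : X × ℝ, 0 < μ (Metric.ball zs.1 zs.2) ∧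
      μ (Metric.ball zs.1 zs.2) < ⊤ ∧ K < oscAux (nuB μ zs.1 zs.2) p f := by
  by_contra! hc
  have := bmo_le hp f K (fun z s h0 h1 => hc (z, s) h0 h1)
  rw [h] at this
  exact absurd hK (not_lt.mpr this)

lemma arith_aux (n : ℕ) (O w v A : ℝ≥0∞) (hO : O ≠ ⊤) (hA : A ≠ ⊤)
    (h1 : O ≤ w + (1 + A))
    (h2 : ENNReal.ofReal ((1 / 9) ^ n) * w ≤ v + 2 * (ENNReal.ofReal ((1 / 9) ^ n / 8) * O))
    (h3 : ENNReal.ofReal (2 * (n * 9 ^ n + 1 + A.toReal)) ≤ O) : (n : ℝ≥0∞) ≤ v := by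
  by_cases hv : v = ⊤
  · simp [hv]
  have e0 : (0 : ℝ) < (1 / 9) ^ n := by positivity
  have hw : w ≠ ⊤ := by
    rintro rfl
    rw [ENNReal.mul_top (by simpa using e0)] at h2
    have : v + 2 * (ENNReal.ofReal ((1 / 9) ^ n / 8) * O) < ⊤ :=
      ENNReal.add_lt_top.2 ⟨lt_top_iff_ne_top.2 hv, ENNReal.mul_lt_top (by simp)
        (ENNReal.mul_lt_top (by simp) (lt_top_iff_ne_top.2 hO))⟩
    exact absurd this (not_lt.mpr h2)
  lift O to NNReal using hO
  lift A to NNReal using hA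
  lift w to NNReal using hw
  lift v to NNReal using hv
  have h1' : (O : ℝ) ≤ w + (1 + A) := by exact_mod_cast h1
  have h3' : 2 * (n * 9 ^ n + 1 + (A : ℝ)) ≤ O := by
    have := ENNReal.toReal_mono (by simp) h3
    rwa [ENNReal.toReal_ofReal (by positivity)] at this
  have h2' : ((1 : ℝ) / 9) ^ n * w ≤ v + 2 * ((1 / 9) ^ n / 8 * O) := by
    have := ENNReal.toReal_mono (by finiteness) h2
    rw [ENNReal.toReal_add (by simp) (by finiteness)] at this
    rw [ENNReal.toReal_mul, ENNReal.toReal_mul, ENNReal.toReal_mul, ENNReal.toReal_ofReal e0.le,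
      ENNReal.toReal_ofReal (show (0 : ℝ) ≤ (1 / 9) ^ n / 8 by positivity)] at this
    exact this
  have e9 : ((1 : ℝ) / 9) ^ n * 9 ^ n = 1 := by rw [← mul_pow]; norm_num
  have hA0 : (0 : ℝ) ≤ A := A.2
  have hw' : (O : ℝ) / 4 + n * 9 ^ n ≤ w := by
    have : (0 : ℝ) ≤ n * 9 ^ n := by positivity
    nlinarith
  have : (n : ℝ) ≤ v := by
    have := mul_le_mul_of_nonneg_left hw' e0.le
    have e : ((1 : ℝ) / 9) ^ n * (O / 4 + n * 9 ^ n) =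
      2 * ((1 / 9) ^ n / 8 * O) + n * ((1 / 9) ^ n * 9 ^ n) := by ring
    rw [e, e9] at this
    linarith
  exact_mod_cast this

theorem stmt_4 {X : Type*} [MetricSpace X] [MeasurableSpace X] [OpensMeasurableSpace X]
    (μ : Measure X) (p₁ p₂ : ℝ) (hp₁ : 1 ≤ p₁) (h12 : p₁ < p₂)
    (f : X → ℝ) (hfloc : ∀ (z : X) (s : ℝ), IntegrableOn f (Metric.ball z s) μ)
    (hf₁ : bmoSeminorm μ p₁ f < ⊤) (hf₂ : bmoSeminorm μ p₂ f = ⊤)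
    (α : ℝ) (hα : 1 < α) :
    ∃ g : X → ℝ, (∀ (z : X) (s : ℝ), IntegrableOn g (Metric.ball z s) μ) ∧
      bmoSeminorm μ (α * p₁) g < ⊤ ∧ bmoSeminorm μ (α * p₂) g = ⊤ := by
  have hp₂ : 1 ≤ p₂ := by linarith
  have hβ0 : 0 < 1 / α := by positivity
  have hβ1 : 1 / α < 1 := by rw [div_lt_one (by linarith)]; exact hα
  have hq₁ : 1 ≤ α * p₁ := by nlinarith
  have hq₂ : 1 ≤ α * p₂ := by nlinarith
  -- it suffices to find a good profile
  suffices hG : ∃ G : ℝ → ℝ, (∃ r, HolLip (1 / α) r G) ∧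
      bmoSeminorm μ (α * p₂) (fun x => G (f x)) = ⊤ by
    obtain ⟨G, ⟨r, hr⟩, hG⟩ := hG
    refine ⟨fun x => G (f x), fun z s => hr.integrable (hfloc z s), ?_, hG⟩
    refine (bmo_le hq₁ _ (2 * (ENNReal.ofReal r * bmoSeminorm μ p₁ f ^ (1 / α)))
      fun z s h0 h1 => ?_).trans_lt ?_
    · haveI := nuB_prob h0 h1
      refine (osc_upper hα hp₁ (nuB_integrable h0 (hfloc z s)) hr).trans ?_
      gcongr
      exact osc_le_bmo h0 h1 hp₁ f
    · exact ENNReal.mul_lt_top (by simp) (ENNReal.mul_lt_top (by simp)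
        (ENNReal.rpow_lt_top_of_nonneg hβ0.le hf₁.ne))
  set A := bmoSeminorm μ p₁ f with hA
  have hlow : ∀ z s, 0 < μ (Metric.ball z s) → μ (Metric.ball z s) < ⊤ →
      oscAux (nuB μ z s) p₂ f ^ (1 / α) ≤ oscAux (nuB μ z s) (α * p₂)
      (fun x => (1 + |f x - ∫ y, f y ∂(nuB μ z s)|) ^ (1 / α)
        - (1 + |0 - ∫ y, f y ∂(nuB μ z s)|) ^ (1 / α)) + (1 + A) := by
    intro z s h0 h1
    haveI := nuB_prob h0 h1
    refine (osc_lower hα hp₂ hp₁ (nuB_integrable h0 (hfloc z s))).trans ?_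
    gcongr
    exact osc_le_bmo h0 h1 hp₁ f
  by_cases hinf : ∃ z s, 0 < μ (Metric.ball z s) ∧ μ (Metric.ball z s) < ⊤ ∧
      oscAux (nuB μ z s) p₂ f = ⊤
  · obtain ⟨z, s, h0, h1, h⟩ := hinf
    refine ⟨_, ⟨1, psi_holLip hβ0 hβ1 (∫ y, f y ∂(nuB μ z s))⟩, ?_⟩
    have h2 := hlow z s h0 h1
    rw [h, ENNReal.top_rpow_of_pos hβ0, top_le_iff, ENNReal.add_eq_top] at h2
    rcases h2 with h2 | h2
    · exact top_le_iff.1 (h2 ▸ osc_le_bmo h0 h1 hq₂ _)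
    · exact absurd h2 (by simpa using hf₁.ne)
  · push Not at hinf
    have hb := fun n : ℕ => exists_ball hp₂ f hf₂
      (ENNReal.ofReal (2 * (n * 9 ^ n + 1 + A.toReal)) ^ α)
      (ENNReal.rpow_lt_top_of_nonneg (by linarith) ENNReal.ofReal_ne_top)
    choose B hB0 hB1 hB2 using hb
    haveI : ∀ n, IsProbabilityMeasure (nuB μ (B n).1 (B n).2) := fun n => nuB_prob (hB0 n) (hB1 n)
    obtain ⟨G, hr, hG⟩ := glide (fun n => nuB μ (B n).1 (B n).2)
      (fun n => nuB_integrable (hB0 n) (hfloc _ _)) hα hp₂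
      (fun n => psi_holLip hβ0 hβ1 (∫ y, f y ∂(nuB μ (B n).1 (B n).2)))
    refine ⟨G, hr, ?_⟩
    refine ENNReal.eq_top_of_forall_nnreal_le fun r => ?_
    obtain ⟨n, hn⟩ := exists_nat_ge r
    refine le_trans (b := (n : ℝ≥0∞)) (by exact_mod_cast hn) ?_
    refine le_trans ?_ (osc_le_bmo (hB0 n) (hB1 n) hq₂ _)
    refine arith_aux n (oscAux (nuB μ (B n).1 (B n).2) p₂ f ^ (1 / α)) _ _ A ?_ hf₁.ne
      (hlow _ _ (hB0 n) (hB1 n)) (hG n) ?_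
    · exact (ENNReal.rpow_lt_top_of_nonneg hβ0.le (hinf _ _ (hB0 n) (hB1 n))).ne
    · have := ENNReal.rpow_le_rpow (hB2 n).le hβ0.le
      rwa [← ENNReal.rpow_mul, mul_one_div_cancel (by linarith), ENNReal.rpow_one] at this
end

section
/- Fix p ∈ (1, ∞), q₀, q₁, r₀, r₁ ∈ [1, ∞] with q₀ < q₁, r₀ < r₁, q₀ ≤ r₀, q₁ ≤ r₁, and θ ∈ (0,1); define 1/q_θ = (1−θ)/q₀ + θ/q₁ and 1/r_θ = (1−θ)/r₀ + θ/r₁. Let (X, ρ, μ) be a metric measure space and suppose the centered Hardy–Littlewood maximal operator M is bounded from L^{p,q₀}(X) to L^{p,r₀}(X) and from L^{p,q₁}(X) to L^{p,r₁}(X). Then M is bounded from L^{p,q_θ}(X) to L^{p,r_θ}(X). -/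
open MeasureTheory
open scoped ENNReal

/-- The Lorentz quasinorm `‖g‖_{p,q}` of an `ℝ≥0∞`-valued function, defined through the
distribution function `t ↦ μ({g > t})`, with the usual modification for `q = ∞`. -/
noncomputable def lNormE {X : Type*} [MeasurableSpace X] (μ : Measure X)
    (p : ℝ) (q : ℝ≥0∞) (g : X → ℝ≥0∞) : ℝ≥0∞ :=
  if q = ⊤ then
    ⨆ (t : ℝ) (_ : 0 < t), ENNReal.ofReal t * μ {x | ENNReal.ofReal t < g x} ^ (1 / p)
  else
    ENNReal.ofReal p ^ (1 / q.toReal) *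
      (∫⁻ t in Set.Ioi (0 : ℝ),
          (ENNReal.ofReal t * μ {x | ENNReal.ofReal t < g x} ^ (1 / p)) ^ q.toReal /
            ENNReal.ofReal t) ^ (1 / q.toReal)

/-- The centered Hardy–Littlewood maximal function (balls of zero or infinite measure
are omitted from the supremum). -/
noncomputable def cMax {X : Type*} [MetricSpace X] [MeasurableSpace X]
    (μ : Measure X) (f : X → ℝ) (x : X) : ℝ≥0∞ :=
  ⨆ (s : ℝ) (_ : 0 < s) (_ : 0 < μ (Metric.ball x s)) (_ : μ (Metric.ball x s) < ⊤),
    (μ (Metric.ball x s))⁻¹ * ∫⁻ y in Metric.ball x s, ENNReal.ofReal |f y| ∂μ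

/-- `M` is bounded from `L^{p,q}(X,μ)` to `L^{p,r}(X,μ)`. -/
def BddMax {X : Type*} [MetricSpace X] [MeasurableSpace X]
    (μ : Measure X) (p : ℝ) (q r : ℝ≥0∞) : Prop :=
  ∃ C : ℝ≥0∞, C < ⊤ ∧ ∀ f : X → ℝ, Measurable f →
    lNormE μ p r (cMax μ f) ≤ C * lNormE μ p q fun x => ENNReal.ofReal |f x|


noncomputable def psiL {X : Type*} [MeasurableSpace X] (μ : Measure X)
    (p : ℝ) (g : X → ℝ≥0∞) (t : ℝ) : ℝ≥0∞ :=
  ENNReal.ofReal t * μ {x | ENNReal.ofReal t < g x} ^ (1 / p)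

noncomputable def nuL : Measure ℝ :=
  (volume.restrict (Set.Ioi 0)).withDensity (fun t => (ENNReal.ofReal t)⁻¹)

instance : SFinite nuL := by unfold nuL; infer_instance

lemma dist_antitone {X : Type*} [MeasurableSpace X] (μ : Measure X) (g : X → ℝ≥0∞) :
    Antitone (fun t : ℝ => μ {x | ENNReal.ofReal t < g x}) := by
  intro s t hst
  apply measure_mono
  intro x hx
  exact lt_of_le_of_lt (ENNReal.ofReal_le_ofReal hst) hx

lemma psiL_meas {X : Type*} [MeasurableSpace X] (μ : Measure X)
    (p : ℝ) (g : X → ℝ≥0∞) : Measurable (psiL μ p g) := by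
  unfold psiL
  exact ENNReal.measurable_ofReal.mul ((dist_antitone μ g).measurable.pow_const _)

lemma lintegral_nuL (h : ℝ → ℝ≥0∞) (hh : Measurable h) :
    ∫⁻ t, h t ∂nuL = ∫⁻ t in Set.Ioi (0 : ℝ), h t / ENNReal.ofReal t := by
  unfold nuL
  rw [lintegral_withDensity_eq_lintegral_mul _ (by fun_prop) hh]
  refine lintegral_congr fun t => ?_
  simp [div_eq_mul_inv, mul_comm]

lemma lNormE_top {X : Type*} [MeasurableSpace X] (μ : Measure X)
    (p : ℝ) (g : X → ℝ≥0∞) :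
    lNormE μ p ⊤ g = ⨆ (t : ℝ) (_ : 0 < t), psiL μ p g t := by
  simp [lNormE, psiL]

lemma lNormE_fin {X : Type*} [MeasurableSpace X] (μ : Measure X)
    (p : ℝ) (q : ℝ≥0∞) (hq : q ≠ ⊤) (g : X → ℝ≥0∞) :
    lNormE μ p q g = ENNReal.ofReal p ^ (1 / q.toReal) *
      (∫⁻ t, psiL μ p g t ^ q.toReal ∂nuL) ^ (1 / q.toReal) := by
  rw [lintegral_nuL _ ((psiL_meas μ p g).pow_const _)]
  simp [lNormE, psiL, hq]

/-- pointwise integral -/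
lemma pw_int (b : ℝ) (hb : 0 < b) (w : ℝ≥0∞) :
    ∫⁻ s in Set.Ioi (0 : ℝ), (if ENNReal.ofReal s < w then ENNReal.ofReal (s ^ (b - 1)) else 0)
      = ENNReal.ofReal b⁻¹ * w ^ b := by
  have key : ∀ T : ℝ, 0 ≤ T → ∫⁻ s in Set.Ioo (0 : ℝ) T, ENNReal.ofReal (s ^ (b - 1))
      = ENNReal.ofReal b⁻¹ * ENNReal.ofReal T ^ b := by
    intro T hT
    have hi : IntervalIntegrable (fun s : ℝ => s ^ (b - 1)) volume 0 T :=
      intervalIntegral.intervalIntegrable_rpow' (by linarith)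
    rw [restrict_Ioo_eq_restrict_Ioc,
      ← ofReal_integral_eq_lintegral_ofReal]
    · rw [← intervalIntegral.integral_of_le hT, integral_rpow (Or.inl (by linarith)),
        ENNReal.ofReal_rpow_of_nonneg hT hb.le, ← ENNReal.ofReal_mul (by positivity)]
      congr 1
      rw [sub_add_cancel, Real.zero_rpow hb.ne']
      field_simp
      simp
    · rw [intervalIntegrable_iff_integrableOn_Ioc_of_le hT] at hi
      exact hi
    · filter_upwards [ae_restrict_mem measurableSet_Ioc] with s hs
      exact Real.rpow_nonneg hs.1.le _
  induction w with
  | top =>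
    simp only [ENNReal.ofReal_lt_top, if_true]
    rw [ENNReal.top_rpow_of_pos hb, ENNReal.mul_top (by simpa using hb)]
    rw [eq_top_iff]
    refine ENNReal.le_of_forall_nnreal_lt fun N _ => ?_
    have h1 := key ((b * N) ^ (1 / b)) (by positivity)
    rw [ENNReal.ofReal_rpow_of_nonneg (by positivity) hb.le, ← Real.rpow_mul (by positivity),
      one_div_mul_cancel hb.ne', Real.rpow_one, ← ENNReal.ofReal_mul (by positivity),
      inv_mul_cancel_left₀ hb.ne', ENNReal.ofReal_coe_nnreal] at h1
    rw [← h1]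
    exact lintegral_mono_set (fun x hx => hx.1)
  | coe w =>
    have := key w w.2
    rw [ENNReal.ofReal_coe_nnreal] at this
    rw [← this, ← lintegral_indicator measurableSet_Ioi, ← lintegral_indicator measurableSet_Ioo]
    refine lintegral_congr fun s => ?_
    simp only [Set.indicator, Set.mem_Ioi, Set.mem_Ioo]
    by_cases hs : 0 < s
    · have : ENNReal.ofReal s < w ↔ s < w := by
        rw [← ENNReal.ofReal_coe_nnreal, ENNReal.ofReal_lt_ofReal_iff_of_nonneg hs.le]
      simp [hs, this]
    · simp [hs]

/-- pointwise integral, upper version -/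
lemma pw_int' (b : ℝ) (hb : 0 < b) (T : ℝ) (hT : 0 < T) :
    ∫⁻ s in Set.Ici (T : ℝ), ENNReal.ofReal (s ^ (-b - 1))
      = ENNReal.ofReal (b⁻¹ * T ^ (-b)) := by
  rw [← restrict_Ioi_eq_restrict_Ici, ← ofReal_integral_eq_lintegral_ofReal]
  · rw [integral_Ioi_rpow_of_lt (by linarith) hT]
    congr 1
    rw [sub_add_cancel]
    field_simp
  · exact integrableOn_Ioi_rpow_of_lt (by linarith) hT
  · filter_upwards [ae_restrict_mem measurableSet_Ioi] with s hs
    exact Real.rpow_nonneg (hT.trans hs).le _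

lemma layer (ν : Measure ℝ) [SFinite ν] (b : ℝ) (hb : 0 < b) (d : ℝ → ℝ≥0∞) (hd : Measurable d) :
    ENNReal.ofReal b⁻¹ * ∫⁻ t, d t ^ b ∂ν =
    ∫⁻ s in Set.Ioi (0 : ℝ), ENNReal.ofReal (s ^ (b - 1)) * ν {t | ENNReal.ofReal s < d t} := by
  rw [← lintegral_const_mul _ (hd.pow_const _)]
  simp_rw [← pw_int b hb]
  rw [lintegral_lintegral_swap]
  · refine lintegral_congr fun s => ?_
    rw [← lintegral_indicator_const (measurableSet_lt measurable_const hd)]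
    refine lintegral_congr fun t => ?_
    simp [Set.indicator]
  · apply Measurable.aemeasurable
    apply Measurable.ite
    · exact measurableSet_lt (by fun_prop) (by fun_prop)
    · fun_prop
    · fun_prop

lemma lam_lt_iff (c γ s : ℝ) (hc : 0 < c) (hγ : 0 < γ) (hs : 0 < s) (a : ℝ≥0∞) :
    ENNReal.ofReal (c * s ^ γ) < a ↔
      ENNReal.ofReal s < (ENNReal.ofReal c⁻¹ * a) ^ (1 / γ) := by
  have h1 : ENNReal.ofReal s = (ENNReal.ofReal (s ^ γ)) ^ (1 / γ) := by
    rw [ENNReal.ofReal_rpow_of_pos (by positivity), ← Real.rpow_mul hs.le,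
      mul_one_div_cancel hγ.ne', Real.rpow_one]
  rw [h1, ENNReal.rpow_lt_rpow_iff (by positivity)]
  rw [ENNReal.ofReal_mul hc.le]
  have hc0 : ENNReal.ofReal c ≠ 0 := by simpa using hc
  rw [ENNReal.ofReal_inv_of_pos hc, ← ENNReal.mul_lt_mul_iff_right hc0 ENNReal.ofReal_ne_top
    (b := ENNReal.ofReal (s ^ γ)), ← mul_assoc, ENNReal.mul_inv_cancel hc0 ENNReal.ofReal_ne_top,
    one_mul]

lemma interp0 (ν : Measure ℝ) [SFinite ν] (a : ℝ → ℝ≥0∞) (ha : Measurable a)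
    (q q0 r r0 γ c : ℝ) (hq0 : 0 < q0) (hq : q0 < q) (hqr : q0 ≤ r0) (hr : r0 < r)
    (hγ : 0 < γ) (hγe : γ * (q - q0) = (r - r0) * (q0 / r0)) (hc : 0 < c) :
    ∫⁻ s in Set.Ioi (0 : ℝ), ENNReal.ofReal (s ^ (r - 1 - r0)) *
      (∫⁻ t, (if ENNReal.ofReal (c * s ^ γ) < a t then a t ^ q0 else 0) ∂ν) ^ (r0 / q0) ≤
    ENNReal.ofReal ((γ * (q - q0))⁻¹ * c ^ (-((q - q0) * (r0 / q0)))) *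
      (∫⁻ t, a t ^ q ∂ν) ^ (r0 / q0) := by
  set I := ∫⁻ t, a t ^ q ∂ν with hI
  set ρ := r0 / q0 - 1 with hρ
  have hr0 : 0 < r0 := hq0.trans_le hqr
  have hρ0 : 0 ≤ ρ := by
    rw [hρ, sub_nonneg, one_le_div hq0]; exact hqr
  set β := γ * (q - q0) with hβ
  have hβ0 : 0 < β := mul_pos hγ (by linarith)
  have hJ : ∀ s : ℝ, 0 < s → (∫⁻ t, (if ENNReal.ofReal (c * s ^ γ) < a t then a t ^ q0 else 0) ∂ν)
      ≤ ENNReal.ofReal ((c * s ^ γ) ^ (q0 - q)) * I := by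
    intro s hs
    have hl : 0 < c * s ^ γ := by positivity
    rw [hI, ← lintegral_const_mul _ (ha.pow_const _)]
    refine lintegral_mono fun t => ?_
    dsimp only
    split_ifs with h
    · have e1 : a t ^ q = a t ^ (q - q0) * a t ^ q0 := by
        rw [← ENNReal.rpow_add_of_nonneg _ _ (by linarith) hq0.le]; congr 1; ring
      rw [e1, ← mul_assoc]
      refine le_mul_of_one_le_left (zero_le) ?_
      calc (1 : ℝ≥0∞) = ENNReal.ofReal ((c * s ^ γ) ^ (q0 - q)) *
            ENNReal.ofReal (c * s ^ γ) ^ (q - q0) := by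
            rw [ENNReal.ofReal_rpow_of_pos hl, ← ENNReal.ofReal_mul (by positivity),
              ← Real.rpow_add hl]
            simp
        _ ≤ _ := by gcongr
    · exact zero_le
  calc _ ≤ ∫⁻ s in Set.Ioi (0 : ℝ), (ENNReal.ofReal (c ^ ((q0 - q) * ρ)) * I ^ ρ) *
        (∫⁻ t, (if ENNReal.ofReal s < (ENNReal.ofReal c⁻¹ * a t) ^ (1 / γ) then
          ENNReal.ofReal (s ^ (β - 1)) else 0) * a t ^ q0 ∂ν) := by
        refine setLIntegral_mono' measurableSet_Ioi fun s hs => ?_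
        have hs : 0 < s := hs
        have e2 : r0 / q0 = ρ + 1 := by rw [hρ]; ring
        rw [e2, ENNReal.rpow_add_of_nonneg _ _ hρ0 zero_le_one, ENNReal.rpow_one]
        have e3 : ∫⁻ t, (if ENNReal.ofReal s < (ENNReal.ofReal c⁻¹ * a t) ^ (1 / γ) then
          ENNReal.ofReal (s ^ (β - 1)) else 0) * a t ^ q0 ∂ν = ENNReal.ofReal (s ^ (β - 1)) *
            ∫⁻ t, (if ENNReal.ofReal (c * s ^ γ) < a t then a t ^ q0 else 0) ∂ν := by
          rw [← lintegral_const_mul']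
          · refine lintegral_congr fun t => ?_
            simp only [lam_lt_iff c γ s hc hγ hs]
            split_ifs <;> simp
          · simp
        rw [e3]
        calc _ ≤ ENNReal.ofReal (s ^ (r - 1 - r0)) *
            ((ENNReal.ofReal ((c * s ^ γ) ^ (q0 - q)) * I) ^ ρ *
            ∫⁻ t, (if ENNReal.ofReal (c * s ^ γ) < a t then a t ^ q0 else 0) ∂ν) := by
              gcongr; exact hJ s hs
          _ = _ := by
              rw [ENNReal.mul_rpow_of_nonneg _ _ hρ0, ENNReal.ofReal_rpow_of_pos (by positivity),
                Real.mul_rpow hc.le (by positivity), Real.mul_rpow (by positivity) (by positivity),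
                ← Real.rpow_mul hc.le, ← Real.rpow_mul hs.le, ← Real.rpow_mul hs.le]
              have e4 : β - 1 = (r - 1 - r0) + (γ * (q0 - q) * ρ) := by
                have : γ * (q0 - q) = - ((r - r0) * (q0 / r0)) := by rw [← hγe]; ring
                rw [this, hγe, hρ]; field_simp; ring
              rw [e4, Real.rpow_add hs, ENNReal.ofReal_mul (Real.rpow_nonneg hs.le _),
                ENNReal.ofReal_mul (Real.rpow_nonneg hc.le _)]
              ring
    _ = (ENNReal.ofReal (c ^ ((q0 - q) * ρ)) * I ^ ρ) * ∫⁻ t, (ENNReal.ofReal β⁻¹ *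
          ((ENNReal.ofReal c⁻¹ * a t) ^ (1 / γ)) ^ β) * a t ^ q0 ∂ν := by
        have hm : Measurable (Function.uncurry fun (s t : ℝ) =>
          (if ENNReal.ofReal s < (ENNReal.ofReal c⁻¹ * a t) ^ (1 / γ) then
            ENNReal.ofReal (s ^ (β - 1)) else 0) * a t ^ q0) := by
          apply Measurable.mul _ (by fun_prop)
          apply Measurable.ite
          · exact measurableSet_lt (by fun_prop) (by fun_prop)
          · fun_prop
          · fun_prop
        rw [lintegral_const_mul _ (by exact hm.lintegral_prod_right'), lintegral_lintegral_swap hm.aemeasurable]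
        congr 1
        refine lintegral_congr fun t => ?_
        rw [lintegral_mul_const, pw_int β hβ0]
        apply Measurable.ite
        · exact measurableSet_lt (by fun_prop) (by fun_prop)
        · fun_prop
        · fun_prop
    _ = (ENNReal.ofReal (c ^ ((q0 - q) * ρ)) * I ^ ρ) *
          (ENNReal.ofReal (β⁻¹ * c ^ (q0 - q)) * I) := by
        congr 1
        rw [hI, ← lintegral_const_mul _ (ha.pow_const _)]
        refine lintegral_congr fun t => ?_
        have e5 : 1 / γ * β = q - q0 := by rw [hβ]; field_simp
        have e1 : a t ^ q = a t ^ (q - q0) * a t ^ q0 := by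
          rw [← ENNReal.rpow_add_of_nonneg _ _ (by linarith) hq0.le]; congr 1; ring
        rw [← ENNReal.rpow_mul, e5, ENNReal.mul_rpow_of_nonneg _ _ (by linarith),
          ENNReal.ofReal_rpow_of_pos (by positivity), Real.inv_rpow hc.le, ← Real.rpow_neg hc.le,
          neg_sub, e1, ENNReal.ofReal_mul (by positivity)]
        ring
    _ = _ := by
        have e2 : r0 / q0 = ρ + 1 := by rw [hρ]; ring
        rw [e2, ENNReal.rpow_add_of_nonneg _ _ hρ0 zero_le_one, ENNReal.rpow_one]
        have e6 : -((q - q0) * (ρ + 1)) = (q0 - q) * ρ + (q0 - q) := by ring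
        rw [e6, Real.rpow_add hc, ENNReal.ofReal_mul (by positivity),
          ENNReal.ofReal_mul (by positivity), ENNReal.ofReal_mul (by positivity)]
        ring
    _ ≤ _ := le_rfl

lemma interp1 (ν : Measure ℝ) [SFinite ν] (a : ℝ → ℝ≥0∞) (ha : Measurable a)
    (q q1 r r1 γ c : ℝ) (hq0 : 0 < q) (hq : q < q1) (hqr : q1 ≤ r1) (hr : r < r1)
    (hγ : 0 < γ) (hγe : γ * (q1 - q) = (r1 - r) * (q1 / r1)) (hc : 0 < c) :
    ∫⁻ s in Set.Ioi (0 : ℝ), ENNReal.ofReal (s ^ (r - 1 - r1)) *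
      (∫⁻ t, (if ENNReal.ofReal (c * s ^ γ) < a t then 0 else a t ^ q1) ∂ν) ^ (r1 / q1) ≤
    ENNReal.ofReal ((γ * (q1 - q))⁻¹ * c ^ ((q1 - q) * (r1 / q1))) *
      (∫⁻ t, a t ^ q ∂ν) ^ (r1 / q1) := by
  set I := ∫⁻ t, a t ^ q ∂ν with hI
  set ρ := r1 / q1 - 1 with hρ
  have hq1 : 0 < q1 := hq0.trans hq
  have hr0 : 0 < r1 := hq1.trans_le hqr
  have hρ0 : 0 ≤ ρ := by
    rw [hρ, sub_nonneg, one_le_div hq1]; exact hqr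
  set β := γ * (q1 - q) with hβ
  have hβ0 : 0 < β := mul_pos hγ (by linarith)
  have e2 : r1 / q1 = ρ + 1 := by rw [hρ]; ring
  have hJ : ∀ s : ℝ, 0 < s → (∫⁻ t, (if ENNReal.ofReal (c * s ^ γ) < a t then 0 else a t ^ q1) ∂ν)
      ≤ ENNReal.ofReal ((c * s ^ γ) ^ (q1 - q)) * I := by
    intro s hs
    have hl : 0 < c * s ^ γ := by positivity
    rw [hI, ← lintegral_const_mul _ (ha.pow_const _)]
    refine lintegral_mono fun t => ?_
    dsimp only
    split_ifs with h
    · exact zero_le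
    · have e1 : a t ^ q1 = a t ^ (q1 - q) * a t ^ q := by
        rw [← ENNReal.rpow_add_of_nonneg _ _ (by linarith) hq0.le]; congr 1; ring
      rw [e1, ← ENNReal.ofReal_rpow_of_pos hl]
      gcongr
      exact not_lt.1 h
  have hm : Measurable (Function.uncurry fun (s t : ℝ) =>
          (if ENNReal.ofReal (c * s ^ γ) < a t then 0 else
            ENNReal.ofReal (s ^ (-β - 1)) * a t ^ q1)) := by
    apply Measurable.ite
    · exact measurableSet_lt (by fun_prop) (by fun_prop)
    · fun_prop
    · fun_prop
  calc _ ≤ ∫⁻ s in Set.Ioi (0 : ℝ), (ENNReal.ofReal (c ^ ((q1 - q) * ρ)) * I ^ ρ) *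
        (∫⁻ t, (if ENNReal.ofReal (c * s ^ γ) < a t then 0 else
            ENNReal.ofReal (s ^ (-β - 1)) * a t ^ q1) ∂ν) := by
        refine setLIntegral_mono' measurableSet_Ioi fun s hs => ?_
        have hs : 0 < s := hs
        rw [e2, ENNReal.rpow_add_of_nonneg _ _ hρ0 zero_le_one, ENNReal.rpow_one]
        have e3 : ∫⁻ t, (if ENNReal.ofReal (c * s ^ γ) < a t then 0 else
            ENNReal.ofReal (s ^ (-β - 1)) * a t ^ q1) ∂ν = ENNReal.ofReal (s ^ (-β - 1)) *
            ∫⁻ t, (if ENNReal.ofReal (c * s ^ γ) < a t then 0 else a t ^ q1) ∂ν := by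
          rw [← lintegral_const_mul']
          · refine lintegral_congr fun t => ?_
            split_ifs <;> simp
          · simp
        rw [e3]
        calc _ ≤ ENNReal.ofReal (s ^ (r - 1 - r1)) *
            ((ENNReal.ofReal ((c * s ^ γ) ^ (q1 - q)) * I) ^ ρ *
            ∫⁻ t, (if ENNReal.ofReal (c * s ^ γ) < a t then 0 else a t ^ q1) ∂ν) := by
              gcongr; exact hJ s hs
          _ = _ := by
              rw [ENNReal.mul_rpow_of_nonneg _ _ hρ0, ENNReal.ofReal_rpow_of_pos (by positivity),
                Real.mul_rpow hc.le (by positivity), Real.mul_rpow (by positivity) (by positivity),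
                ← Real.rpow_mul hc.le, ← Real.rpow_mul hs.le, ← Real.rpow_mul hs.le]
              have e4 : -β - 1 = (r - 1 - r1) + (γ * (q1 - q) * ρ) := by
                rw [← hβ, hγe, hρ]; field_simp; ring
              rw [e4, Real.rpow_add hs, ENNReal.ofReal_mul (Real.rpow_nonneg hs.le _),
                ENNReal.ofReal_mul (Real.rpow_nonneg hc.le _)]
              ring
    _ = (ENNReal.ofReal (c ^ ((q1 - q) * ρ)) * I ^ ρ) * ∫⁻ t, (∫⁻ s in Set.Ioi (0 : ℝ),
          (if ENNReal.ofReal (c * s ^ γ) < a t then 0 else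
            ENNReal.ofReal (s ^ (-β - 1)) * a t ^ q1)) ∂ν := by
        rw [lintegral_const_mul _ (by exact hm.lintegral_prod_right'), lintegral_lintegral_swap hm.aemeasurable]
    _ ≤ (ENNReal.ofReal (c ^ ((q1 - q) * ρ)) * I ^ ρ) *
          (ENNReal.ofReal (β⁻¹ * c ^ (q1 - q)) * I) := by
        gcongr
        rw [hI, ← lintegral_const_mul _ (ha.pow_const _)]
        refine lintegral_mono fun t => ?_
        dsimp only
        induction hat : a t with
        | top => simp
        | coe w =>
          rcases eq_or_ne w 0 with rfl | hw
          · simp [hq1]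
          have hw : (0 : ℝ) < w := by positivity
          rw [← ENNReal.ofReal_coe_nnreal]
          set T := ((w : ℝ) / c) ^ (1 / γ) with hT
          have hT0 : 0 < T := by positivity
          calc _ ≤ ∫⁻ s in Set.Ici T, ENNReal.ofReal (s ^ (-β - 1)) *
              ENNReal.ofReal w ^ q1 := by
                rw [← lintegral_indicator measurableSet_Ioi, ← lintegral_indicator measurableSet_Ici]
                refine lintegral_mono fun s => ?_
                by_cases hs : 0 < s
                · simp only [Set.indicator, Set.mem_Ioi, hs, if_true, Set.mem_Ici]
                  by_cases hTs : T ≤ s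
                  · rw [if_pos hTs]; split_ifs <;> simp
                  · have : ENNReal.ofReal (c * s ^ γ) < ENNReal.ofReal w := by
                      rw [ENNReal.ofReal_lt_ofReal_iff hw]
                      have h1 : s ^ γ < w / c := by
                        have := Real.rpow_lt_rpow hs.le (not_le.1 hTs) hγ
                        rwa [hT, ← Real.rpow_mul (by positivity), one_div_mul_cancel hγ.ne',
                          Real.rpow_one] at this
                      rw [lt_div_iff₀ hc] at h1
                      linarith
                    rw [if_pos this]; exact zero_le
                · simp [Set.indicator, hs]
            _ = ENNReal.ofReal (β⁻¹ * T ^ (-β)) * ENNReal.ofReal w ^ q1 := by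
                rw [lintegral_mul_const _ (by fun_prop), pw_int' β hβ0 T hT0]
            _ = _ := by
                have e5 : 1 / γ * -β = -(q1 - q) := by rw [hβ]; field_simp
                rw [ENNReal.ofReal_rpow_of_pos hw, ENNReal.ofReal_rpow_of_pos hw,
                  ← ENNReal.ofReal_mul (by positivity), ← ENNReal.ofReal_mul (by positivity),
                  hT, ← Real.rpow_mul (by positivity), e5, Real.div_rpow hw.le hc.le]
                have e6 : (w : ℝ) ^ q1 = w ^ (q1 - q) * w ^ q := by
                  rw [← Real.rpow_add hw]; congr 1; ring
                rw [e6, Real.rpow_neg hw.le, Real.rpow_neg hc.le]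
                congr 1
                field_simp
    _ = _ := by
        rw [e2, ENNReal.rpow_add_of_nonneg _ _ hρ0 zero_le_one, ENNReal.rpow_one]
        have e6 : ((q1 - q) * (ρ + 1)) = (q1 - q) * ρ + (q1 - q) := by ring
        rw [e6, Real.rpow_add hc, ENNReal.ofReal_mul (by positivity),
          ENNReal.ofReal_mul (by positivity), ENNReal.ofReal_mul (by positivity)]
        ring

noncomputable def phiL (A : Set ℝ) (T : ℝ) : ℝ := 2 * (volume (A ∩ Set.Ioc 0 T)).toReal

lemma phiL_fin (A : Set ℝ) (T : ℝ) : volume (A ∩ Set.Ioc 0 T) ≠ ⊤ :=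
  ((measure_mono Set.inter_subset_right).trans_lt (by simp)).ne

lemma phiL_nonneg (A : Set ℝ) (T : ℝ) : 0 ≤ phiL A T := by unfold phiL; positivity

lemma phiL_mono (A : Set ℝ) : Monotone (phiL A) := by
  intro s t hst
  unfold phiL
  have := ENNReal.toReal_mono (phiL_fin A t)
    (measure_mono (Set.inter_subset_inter_right A (Set.Ioc_subset_Ioc_right hst)))
  linarith

lemma phiL_ofReal (A : Set ℝ) (T : ℝ) :
    ENNReal.ofReal (phiL A T) = 2 * volume (A ∩ Set.Ioc 0 T) := by
  unfold phiL
  rw [ENNReal.ofReal_mul (by norm_num), ENNReal.ofReal_toReal (phiL_fin A T)]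
  simp

lemma phiL_zero (A : Set ℝ) : phiL A 0 = 0 := by simp [phiL]

lemma phiL_sub (A : Set ℝ) (S T : ℝ) (hST : S ≤ T) : phiL A T ≤ phiL A S + 2 * (T - S) := by
  unfold phiL
  have h1 : volume (A ∩ Set.Ioc 0 T) ≤ volume (A ∩ Set.Ioc 0 S) + volume (Set.Ioc S T) := by
    refine (measure_mono ?_).trans (measure_union_le _ _)
    rintro x ⟨hx, h0, hT⟩
    by_cases hxS : x ≤ S
    · exact Or.inl ⟨hx, h0, hxS⟩
    · exact Or.inr ⟨not_le.1 hxS, hT⟩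
  have h2 := ENNReal.toReal_mono (by simp [phiL_fin]) h1
  rw [ENNReal.toReal_add (phiL_fin A S) (by simp), Real.volume_Ioc,
    ENNReal.toReal_ofReal (by linarith)] at h2
  linarith

lemma phiL_le (A : Set ℝ) (T : ℝ) (hT : 0 ≤ T) : phiL A T ≤ 2 * T := by
  have := phiL_sub A 0 T hT
  rw [phiL_zero] at this
  linarith

lemma phiL_cont (A : Set ℝ) : Continuous (phiL A) := by
  refine LipschitzWith.continuous (K := 2) (LipschitzWith.of_le_add_mul _ fun x y => ?_)
  rcases le_total y x with h | h
  · rw [Real.dist_eq, abs_of_nonneg (by linarith)]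
    exact phiL_sub A y x h
  · exact (phiL_mono A h).trans (by simp)

lemma phiL_add (A : Set ℝ) (hA : MeasurableSet A) (T : ℝ) (hT : 0 ≤ T) :
    phiL A T + phiL Aᶜ T = 2 * T := by
  unfold phiL
  rw [← mul_add, ← ENNReal.toReal_add (phiL_fin _ _) (phiL_fin _ _), Set.inter_comm A,
    Set.inter_comm Aᶜ, ← Set.sdiff_eq, measure_inter_add_sdiff _ hA]
  simp [hT]

lemma phiL_push (A : Set ℝ) (hA : MeasurableSet A) (N : ℝ) (hN : 0 ≤ N) :
    volume.restrict (Set.Ioc 0 (phiL A N)) =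
      Measure.map (phiL A) ((2 : ℝ≥0∞) • volume.restrict (A ∩ Set.Ioc 0 N)) := by
  have hmeas : Measurable (phiL A) := (phiL_mono A).measurable
  have : IsFiniteMeasure (volume.restrict (Set.Ioc 0 (phiL A N))) := ⟨by simp⟩
  refine Measure.ext_of_Iic _ _ fun s => ?_
  rw [Measure.map_apply hmeas measurableSet_Iic, Measure.smul_apply,
    Measure.restrict_apply measurableSet_Iic,
    Measure.restrict_apply (hmeas measurableSet_Iic), smul_eq_mul]
  rcases lt_or_ge s 0 with hs | hs
  · have h1 : Set.Iic s ∩ Set.Ioc 0 (phiL A N) = ∅ := by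
      ext x; simp only [Set.mem_inter_iff, Set.mem_Iic, Set.mem_Ioc, Set.mem_empty_iff_false]
      constructor
      · rintro ⟨h1, h2, h3⟩; linarith
      · simp
    have h2 : phiL A ⁻¹' Set.Iic s = ∅ := by
      ext x; simp only [Set.mem_preimage, Set.mem_Iic, Set.mem_empty_iff_false]
      have := phiL_nonneg A x
      constructor
      · intro; linarith
      · simp
    simp [h1, h2]
  obtain ⟨T, hT⟩ : ∃ T, IsGreatest (Set.Icc 0 N ∩ phiL A ⁻¹' Set.Iic s) T := by
    apply IsCompact.exists_isGreatest
    · exact isCompact_Icc.inter_right (isClosed_Iic.preimage (phiL_cont A))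
    · exact ⟨0, ⟨le_rfl, hN⟩, by simpa [phiL_zero] using hs⟩
  have hTs : phiL A T = min s (phiL A N) := by
    apply le_antisymm
    · exact le_min hT.1.2 (phiL_mono A hT.1.1.2)
    · obtain ⟨T', hT', hT'e⟩ := intermediate_value_Icc hN (phiL_cont A).continuousOn
        (show min s (phiL A N) ∈ Set.Icc (phiL A 0) (phiL A N) from
          ⟨by rw [phiL_zero]; exact le_min hs (phiL_nonneg _ _), min_le_right _ _⟩)
      rw [← hT'e]
      apply phiL_mono
      apply hT.2 ⟨hT', ?_⟩
      simp [hT'e]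
  have h3 : phiL A ⁻¹' Set.Iic s ∩ (A ∩ Set.Ioc 0 N) = A ∩ Set.Ioc 0 T := by
    ext x
    constructor
    · rintro ⟨h1, h2, h3⟩
      exact ⟨h2, h3.1, hT.2 ⟨⟨h3.1.le, h3.2⟩, h1⟩⟩
    · rintro ⟨h1, h2, h3⟩
      exact ⟨(phiL_mono A h3).trans hT.1.2, h1, h2, h3.trans hT.1.1.2⟩
  rw [h3, ← phiL_ofReal, hTs]
  have h4 : Set.Iic s ∩ Set.Ioc 0 (phiL A N) = Set.Ioc 0 (min s (phiL A N)) := by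
    ext x; simp; tauto
  rw [h4, Real.volume_Ioc, sub_zero]

lemma phiL_lint (A : Set ℝ) (hA : MeasurableSet A) (h : ℝ → ℝ≥0∞) (hh : Measurable h)
    (h0 : ∀ s, 0 < s → (∀ T, phiL A T ≤ s) → h s = 0) :
    ∫⁻ s in Set.Ioi 0, h s ≤ 2 * ∫⁻ t in A ∩ Set.Ioi 0, h (phiL A t) := by
  have hmeas : Measurable (phiL A) := (phiL_mono A).measurable
  have e1 : ∫⁻ s in Set.Ioi 0, h s = ∫⁻ s in ⋃ n : ℕ, Set.Ioc 0 (phiL A n), h s := by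
    rw [← lintegral_indicator measurableSet_Ioi,
      ← lintegral_indicator (MeasurableSet.iUnion fun n => measurableSet_Ioc)]
    refine lintegral_congr fun s => ?_
    by_cases hs : s ∈ ⋃ n : ℕ, Set.Ioc 0 (phiL A n)
    · have : s ∈ Set.Ioi (0 : ℝ) := by
        rw [Set.mem_iUnion] at hs
        obtain ⟨n, hn⟩ := hs
        exact hn.1
      simp [Set.indicator, hs, this]
    · rw [Set.indicator_of_notMem hs]
      by_cases hs0 : s ∈ Set.Ioi (0 : ℝ)
      · rw [Set.indicator_of_mem hs0]
        apply h0 s hs0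
        intro T
        by_contra hcon
        apply hs
        rw [Set.mem_iUnion]
        obtain ⟨n, hn⟩ := exists_nat_ge T
        exact ⟨n, hs0, (not_le.1 hcon).le.trans (phiL_mono A hn)⟩
      · rw [Set.indicator_of_notMem hs0]
  rw [e1, setLIntegral_iUnion_of_directed]
  · refine iSup_le fun n => ?_
    rw [phiL_push A hA n (Nat.cast_nonneg n), lintegral_map hh hmeas, lintegral_smul_measure,
      smul_eq_mul]
    gcongr
    exact fun x hx => hx.1
  · apply Monotone.directed_le
    intro m n hmn
    exact Set.Ioc_subset_Ioc_right (phiL_mono A (by exact_mod_cast hmn))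

lemma psi_pw (q s : ℝ) (hq : 0 < q) (hs : 0 < s) (y : ℝ≥0∞) :
    (ENNReal.ofReal s * y) ^ q / ENNReal.ofReal s = ENNReal.ofReal (s ^ (q - 1)) * y ^ q := by
  rw [ENNReal.mul_rpow_of_nonneg _ _ hq.le, div_eq_mul_inv, ← ENNReal.ofReal_inv_of_pos hs,
    ENNReal.ofReal_rpow_of_pos hs, Real.rpow_sub_one hs.ne', div_eq_mul_inv,
    ENNReal.ofReal_mul (by positivity)]
  ring

lemma psi_trunc {X : Type*} [MeasurableSpace X] (μ : Measure X) (p : ℝ) (hp : 1 < p)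
    (q : ℝ) (hq : 1 ≤ q) (f : X → ℝ) (A : Set ℝ) (hA : MeasurableSet A) :
    ∫⁻ t, psiL μ p (fun x => ENNReal.ofReal |phiL A (|f x|)|) t ^ q ∂nuL ≤
      ENNReal.ofReal (2 ^ q) *
        ∫⁻ t, A.indicator (fun t => psiL μ p (fun x => ENNReal.ofReal |f x|) t ^ q) t ∂nuL := by
  have hq0 : 0 < q := by linarith
  have hp0 : 0 < p := by linarith
  set F : X → ℝ≥0∞ := fun x => ENNReal.ofReal |phiL A (|f x|)|
  set G : X → ℝ≥0∞ := fun x => ENNReal.ofReal |f x|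
  have m1 : Measurable fun t => psiL μ p F t ^ q := (psiL_meas μ p F).pow_const _
  have m2 : Measurable fun t => psiL μ p G t ^ q := (psiL_meas μ p G).pow_const _
  have m3 : Measurable fun t => psiL μ p F t ^ q / ENNReal.ofReal t := m1.div (by fun_prop)
  rw [lintegral_nuL _ m1, lintegral_nuL _ (m2.indicator hA)]
  refine (phiL_lint A hA _ m3 ?_).trans ?_
  · intro s hs hT
    have : {x | ENNReal.ofReal s < F x} = ∅ := by
      ext x
      simp only [Set.mem_ofPred_eq, Set.mem_empty_iff_false, iff_false, not_lt, F]
      rw [abs_of_nonneg (phiL_nonneg _ _)]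
      exact ENNReal.ofReal_le_ofReal (hT _)
    simp [psiL, this, hp0, hq0]
  · have e1 : ∫⁻ t in Set.Ioi 0, A.indicator (fun t => psiL μ p G t ^ q) t / ENNReal.ofReal t
      = ∫⁻ t in A ∩ Set.Ioi 0, psiL μ p G t ^ q / ENNReal.ofReal t := by
      rw [← Measure.restrict_restrict hA, ← lintegral_indicator hA]
      refine lintegral_congr fun t => ?_
      by_cases ht : t ∈ A <;> simp [ht]
    rw [e1]
    have e2 : ENNReal.ofReal (2 ^ q) = 2 * ENNReal.ofReal (2 ^ (q - 1)) := by
      rw [Real.rpow_sub_one (by norm_num), ← ENNReal.ofReal_ofNat 2,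
        ← ENNReal.ofReal_mul (by norm_num)]
      congr 1
      ring
    rw [e2, mul_assoc, ← lintegral_const_mul' _ _ ENNReal.ofReal_ne_top]
    gcongr 2 * ?_
    refine setLIntegral_mono' (hA.inter measurableSet_Ioi) fun t ht => ?_
    have ht0 : 0 < t := ht.2
    rcases (phiL_nonneg A t).eq_or_lt with h | h
    · rw [← h]; simp [psiL, hq0]
    · simp only [psiL]
      rw [psi_pw _ _ hq0 h, psi_pw _ _ hq0 ht0, ← mul_assoc,
        ← ENNReal.ofReal_mul (by positivity), ← Real.mul_rpow (by norm_num) ht0.le]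
      refine mul_le_mul' (ENNReal.ofReal_le_ofReal
        (Real.rpow_le_rpow h.le (phiL_le A t ht0.le) (by linarith)))
        (ENNReal.rpow_le_rpow (ENNReal.rpow_le_rpow (measure_mono ?_) (by positivity)) hq0.le)
      · intro x hx
        simp only [F, G, Set.mem_ofPred_eq] at hx ⊢
        rw [abs_of_nonneg (phiL_nonneg _ _), ENNReal.ofReal_lt_ofReal_iff_of_nonneg h.le] at hx
        rw [ENNReal.ofReal_lt_ofReal_iff_of_nonneg ht0.le]
        exact (phiL_mono A).reflect_lt hx

lemma psi_trunc_top {X : Type*} [MeasurableSpace X] (μ : Measure X) (p : ℝ) (hp : 1 < p)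
    (f : X → ℝ) (A : Set ℝ) (l : ℝ≥0∞)
    (hl : ∀ t ∈ A, 0 < t → psiL μ p (fun x => ENNReal.ofReal |f x|) t ≤ l) (t : ℝ) (ht : 0 < t) :
    psiL μ p (fun x => ENNReal.ofReal |phiL A (|f x|)|) t ≤ 4 * l := by
  have hp0 : 0 < p := by linarith
  by_cases hex : ∃ T ∈ A, t / 4 ≤ T ∧ ∀ x, t < phiL A (|f x|) → T < |f x|
  · obtain ⟨T, hTA, hTt, hx⟩ := hex
    have hT0 : 0 < T := by linarith
    calc _ ≤ 4 * psiL μ p (fun x => ENNReal.ofReal |f x|) T := by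
          simp only [psiL]
          rw [← mul_assoc, ← ENNReal.ofReal_ofNat 4, ← ENNReal.ofReal_mul (by norm_num)]
          refine mul_le_mul' (ENNReal.ofReal_le_ofReal (by linarith))
            (ENNReal.rpow_le_rpow (measure_mono ?_) (by positivity))
          · intro x hx'
            rw [Set.mem_ofPred_eq] at hx' ⊢
            rw [abs_of_nonneg (phiL_nonneg _ _), ENNReal.ofReal_lt_ofReal_iff_of_nonneg ht.le] at hx'
            rw [ENNReal.ofReal_lt_ofReal_iff_of_nonneg hT0.le]
            exact hx _ hx'
      _ ≤ _ := by gcongr; exact hl T hTA hT0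
  · have hle : ∀ T, phiL A T ≤ t := by
      push Not at hex
      have hB : ∀ T ∈ A, t / 4 ≤ T → t < phiL A T := by
        intro T hT hTt
        obtain ⟨x, h1, h2⟩ := hex T hT hTt
        exact h1.trans_le (phiL_mono A h2)
      have hq : phiL A (t / 4) ≤ t / 2 := by
        have := phiL_le A (t / 4) (by linarith); linarith
      by_cases hne : (A ∩ Set.Ici (t / 4)).Nonempty
      · exfalso
        set T0 := sInf (A ∩ Set.Ici (t / 4)) with hT0
        have hbdd : BddBelow (A ∩ Set.Ici (t / 4)) := ⟨t / 4, fun x hx => hx.2⟩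
        obtain ⟨T, hT, hTlt⟩ := exists_lt_of_csInf_lt hne (show T0 < T0 + t / 8 by linarith)
        have h1 := hB T hT.1 hT.2
        have hT0T : T0 ≤ T := csInf_le hbdd hT
        have h2 : phiL A T0 ≤ phiL A (t / 4) := by
          unfold phiL
          have : volume (A ∩ Set.Ioc 0 T0) ≤ volume (A ∩ Set.Ioc 0 (t / 4)) := by
            have hae : (A ∩ Set.Ioo 0 T0 : Set ℝ) =ᵐ[volume] (A ∩ Set.Ioc 0 T0 : Set ℝ) :=
              (Filter.EventuallyEq.refl _ A).inter Ioo_ae_eq_Ioc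
            rw [← measure_congr hae]
            apply measure_mono
            rintro x ⟨hxA, hx0, hxT⟩
            refine ⟨hxA, hx0, ?_⟩
            by_contra hcon
            exact absurd (csInf_le hbdd ⟨hxA, (not_le.1 hcon).le⟩) (not_le.2 hxT)
          have := ENNReal.toReal_mono (phiL_fin A _) this
          linarith
        have h3 := phiL_sub A T0 T hT0T
        linarith
      · intro T
        have : phiL A T ≤ phiL A (t / 4) := by
          unfold phiL
          have : volume (A ∩ Set.Ioc 0 T) ≤ volume (A ∩ Set.Ioc 0 (t / 4)) := by
            apply measure_mono
            rintro x ⟨hxA, hx0, hxT⟩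
            refine ⟨hxA, hx0, ?_⟩
            by_contra hcon
            exact hne ⟨x, hxA, (not_le.1 hcon).le⟩
          have := ENNReal.toReal_mono (phiL_fin A _) this
          linarith
        linarith
    have : {x | ENNReal.ofReal t < ENNReal.ofReal |phiL A (|f x|)|} = ∅ := by
      ext x
      simp only [Set.mem_ofPred_eq, Set.mem_empty_iff_false, iff_false, not_lt]
      rw [abs_of_nonneg (phiL_nonneg _ _)]
      exact ENNReal.ofReal_le_ofReal (hle _)
    simp [psiL, this, hp0]

lemma psi_sup {X : Type*} [MeasurableSpace X] (μ : Measure X) (p : ℝ) (hp : 0 < p)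
    (q : ℝ) (hq : 0 < q) (g : X → ℝ≥0∞) (t : ℝ) :
    psiL μ p g t ^ q ≤ ENNReal.ofReal q * ∫⁻ s, psiL μ p g s ^ q ∂nuL := by
  rcases le_or_gt t 0 with ht | ht
  · simp [psiL, ENNReal.ofReal_of_nonpos ht, hq]
  have h1 := pw_int q hq (ENNReal.ofReal t)
  have m1 : Measurable fun t => psiL μ p g t ^ q := (psiL_meas μ p g).pow_const _
  rw [lintegral_nuL _ m1]
  set y := μ {x | ENNReal.ofReal t < g x} ^ (1 / p) with hy
  have h2 : ENNReal.ofReal q⁻¹ * psiL μ p g t ^ q ≤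
      ∫⁻ s in Set.Ioi (0 : ℝ), psiL μ p g s ^ q / ENNReal.ofReal s := by
    calc ENNReal.ofReal q⁻¹ * psiL μ p g t ^ q
        = (∫⁻ s in Set.Ioi (0 : ℝ), (if ENNReal.ofReal s < ENNReal.ofReal t then
          ENNReal.ofReal (s ^ (q - 1)) else 0)) * y ^ q := by
          rw [h1, psiL, ENNReal.mul_rpow_of_nonneg _ _ hq.le, mul_assoc]
      _ = ∫⁻ s in Set.Ioi (0 : ℝ), (if ENNReal.ofReal s < ENNReal.ofReal t then
          ENNReal.ofReal (s ^ (q - 1)) else 0) * y ^ q := by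
          rw [lintegral_mul_const]
          apply Measurable.ite
          · exact measurableSet_lt (by fun_prop) (by fun_prop)
          · fun_prop
          · fun_prop
      _ ≤ _ := by
          refine setLIntegral_mono' measurableSet_Ioi fun s hs => ?_
          have hs : 0 < s := hs
          split_ifs with h
          · rw [psiL, psi_pw _ _ hq hs]
            rw [ENNReal.ofReal_lt_ofReal_iff ht] at h
            refine mul_le_mul' le_rfl (ENNReal.rpow_le_rpow (ENNReal.rpow_le_rpow ?_ (by positivity)) hq.le)
            exact dist_antitone μ g h.le
          · simp
  calc psiL μ p g t ^ q = ENNReal.ofReal q * (ENNReal.ofReal q⁻¹ * psiL μ p g t ^ q) := by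
        rw [← mul_assoc, ← ENNReal.ofReal_mul hq.le, mul_inv_cancel₀ hq.ne']; simp
    _ ≤ _ := by gcongr

lemma p_pow_ne (p x : ℝ) (hp : 0 < p) : ENNReal.ofReal p ^ x ≠ 0 ∧ ENNReal.ofReal p ^ x ≠ ⊤ := by
  rw [ENNReal.ofReal_rpow_of_pos hp]
  refine ⟨?_, ENNReal.ofReal_ne_top⟩
  have : 0 < p ^ x := by positivity
  simpa using this

lemma toReal_pos' (q : ℝ≥0∞) (hq : 1 ≤ q) (h : q ≠ ⊤) : 1 ≤ q.toReal := by
  have := ENNReal.toReal_mono h hq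
  simpa using this

lemma nest {X : Type*} [MeasurableSpace X] (μ : Measure X) (p : ℝ) (hp : 0 < p)
    (q r : ℝ≥0∞) (hq : 1 ≤ q) (hqr : q ≤ r) :
    ∃ K : ℝ≥0∞, K ≠ ⊤ ∧ ∀ g : X → ℝ≥0∞, lNormE μ p r g ≤ K * lNormE μ p q g := by
  rcases eq_or_ne q ⊤ with hqt | hqt
  · have : r = ⊤ := top_le_iff.1 (hqt ▸ hqr)
    refine ⟨1, by simp, fun g => ?_⟩
    rw [hqt, this, one_mul]
  have hq0 : 0 < q.toReal := by have := toReal_pos' q hq hqt; linarith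
  obtain ⟨n1, n2⟩ := p_pow_ne p (1 / q.toReal) hp
  have hE : ∀ g : X → ℝ≥0∞, (∫⁻ t, psiL μ p g t ^ q.toReal ∂nuL) ^ (1 / q.toReal) =
      (ENNReal.ofReal p ^ (1 / q.toReal))⁻¹ * lNormE μ p q g := by
    intro g
    rw [lNormE_fin μ p q hqt, ← mul_assoc, ENNReal.inv_mul_cancel n1 n2, one_mul]
  have hsup : ∀ (g : X → ℝ≥0∞) t, psiL μ p g t ≤ ENNReal.ofReal q.toReal ^ (1 / q.toReal) *
      (∫⁻ t, psiL μ p g t ^ q.toReal ∂nuL) ^ (1 / q.toReal) := by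
    intro g t
    rw [← ENNReal.mul_rpow_of_nonneg _ _ (by positivity), one_div,
      ENNReal.le_rpow_inv_iff hq0]
    exact psi_sup μ p hp _ hq0 g t
  rcases eq_or_ne r ⊤ with hrt | hrt
  · refine ⟨ENNReal.ofReal q.toReal ^ (1 / q.toReal) * (ENNReal.ofReal p ^ (1 / q.toReal))⁻¹,
      ENNReal.mul_ne_top (p_pow_ne _ _ hq0).2 (ENNReal.inv_ne_top.2 n1), fun g => ?_⟩
    rw [hrt, lNormE_top, mul_assoc, ← hE]
    exact iSup₂_le fun t _ => hsup g t
  · have hqr' : q.toReal ≤ r.toReal := ENNReal.toReal_mono hrt hqr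
    have hr0 : 0 < r.toReal := by linarith
    refine ⟨ENNReal.ofReal p ^ (1 / r.toReal) *
      ((ENNReal.ofReal q.toReal ^ (1 / q.toReal)) ^ (r.toReal - q.toReal)) ^ (1 / r.toReal) *
      (ENNReal.ofReal p ^ (1 / q.toReal))⁻¹, ?_, fun g => ?_⟩
    · refine ENNReal.mul_ne_top (ENNReal.mul_ne_top (p_pow_ne _ _ hp).2 ?_)
        (ENNReal.inv_ne_top.2 n1)
      exact ENNReal.rpow_ne_top_of_nonneg (by positivity)
        (ENNReal.rpow_ne_top_of_nonneg (by linarith) (p_pow_ne _ _ hq0).2)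
    · rw [lNormE_fin μ p r hrt, mul_assoc, mul_assoc, ← hE]
      refine mul_le_mul' le_rfl ?_
      set I := ∫⁻ t, psiL μ p g t ^ q.toReal ∂nuL with hI
      set S := ENNReal.ofReal q.toReal ^ (1 / q.toReal)
      have h1 : ∫⁻ t, psiL μ p g t ^ r.toReal ∂nuL ≤
          (S * I ^ (1 / q.toReal)) ^ (r.toReal - q.toReal) * I := by
        rw [hI, ← lintegral_const_mul _ ((psiL_meas μ p g).pow_const _)]
        refine lintegral_mono fun t => ?_
        have : psiL μ p g t ^ r.toReal =
            psiL μ p g t ^ (r.toReal - q.toReal) * psiL μ p g t ^ q.toReal := by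
          rw [← ENNReal.rpow_add_of_nonneg _ _ (by linarith) hq0.le]; congr 1; ring
        rw [this]
        refine mul_le_mul' ?_ le_rfl
        exact ENNReal.rpow_le_rpow (hsup g t) (by linarith)
      have h2 : (S * I ^ (1 / q.toReal)) ^ (r.toReal - q.toReal) * I =
          S ^ (r.toReal - q.toReal) * I ^ (r.toReal / q.toReal) := by
        rw [ENNReal.mul_rpow_of_nonneg _ _ (by linarith), mul_assoc, ← ENNReal.rpow_mul I]
        congr 1
        nth_rw 2 [← ENNReal.rpow_one I]
        rw [← ENNReal.rpow_add_of_nonneg _ _ (mul_nonneg (by positivity) (by linarith)) zero_le_one]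
        congr 1
        field_simp
        ring
      calc _ ≤ (S ^ (r.toReal - q.toReal) * I ^ (r.toReal / q.toReal)) ^ (1 / r.toReal) := by
            rw [← h2]
            exact ENNReal.rpow_le_rpow h1 (by positivity)
        _ = _ := by
            rw [ENNReal.mul_rpow_of_nonneg _ _ (by positivity), ← ENNReal.rpow_mul I]
            congr 2
            field_simp

lemma bdd_fin {X : Type*} [MetricSpace X] [MeasurableSpace X]
    (μ : Measure X) (p : ℝ) (hp : 0 < p) (q r : ℝ≥0∞) (hq : 1 ≤ q) (hr : 1 ≤ r)
    (hqt : q ≠ ⊤) (hrt : r ≠ ⊤) :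
    BddMax μ p q r ↔ ∃ K : ℝ≥0∞, K ≠ ⊤ ∧ ∀ f : X → ℝ, Measurable f →
      ∫⁻ t, psiL μ p (cMax μ f) t ^ r.toReal ∂nuL ≤
        K * (∫⁻ t, psiL μ p (fun x => ENNReal.ofReal |f x|) t ^ q.toReal ∂nuL)
          ^ (r.toReal / q.toReal) := by
  have hq0 : 0 < q.toReal := by have := toReal_pos' q hq hqt; linarith
  have hr0 : 0 < r.toReal := by have := toReal_pos' r hr hrt; linarith
  obtain ⟨n1, n2⟩ := p_pow_ne p (1 / q.toReal) hp
  obtain ⟨n3, n4⟩ := p_pow_ne p (1 / r.toReal) hp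
  constructor
  · rintro ⟨C, hC, h⟩
    refine ⟨((ENNReal.ofReal p ^ (1 / r.toReal))⁻¹ * (C * ENNReal.ofReal p ^ (1 / q.toReal)))
      ^ r.toReal, ?_, fun f hf => ?_⟩
    · exact ENNReal.rpow_ne_top_of_nonneg hr0.le
        (ENNReal.mul_ne_top (ENNReal.inv_ne_top.2 n3) (ENNReal.mul_ne_top hC.ne n2))
    · have := h f hf
      rw [lNormE_fin _ _ _ hqt, lNormE_fin _ _ _ hrt] at this
      have h2 := mul_le_mul_right this (ENNReal.ofReal p ^ (1 / r.toReal))⁻¹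
      rw [← mul_assoc, ENNReal.inv_mul_cancel n3 n4, one_mul] at h2
      have h3 := ENNReal.rpow_le_rpow h2 hr0.le
      rw [← ENNReal.rpow_mul, one_div_mul_cancel hr0.ne', ENNReal.rpow_one] at h3
      refine h3.trans (le_of_eq ?_)
      rw [← mul_assoc C, ← mul_assoc, ENNReal.mul_rpow_of_nonneg _ _ hr0.le, ← ENNReal.rpow_mul]
      congr 2
      field_simp
  · rintro ⟨K, hK, h⟩
    refine ⟨ENNReal.ofReal p ^ (1 / r.toReal) * (K ^ (1 / r.toReal) *
      (ENNReal.ofReal p ^ (1 / q.toReal))⁻¹), ?_, fun f hf => ?_⟩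
    · exact (ENNReal.mul_ne_top n4 (ENNReal.mul_ne_top
        (ENNReal.rpow_ne_top_of_nonneg (by positivity) hK) (ENNReal.inv_ne_top.2 n1))).lt_top
    · rw [lNormE_fin _ _ _ hqt, lNormE_fin _ _ _ hrt, mul_assoc, mul_assoc, ← mul_assoc _⁻¹,
        ENNReal.inv_mul_cancel n1 n2, one_mul]
      refine mul_le_mul' le_rfl ?_
      refine (ENNReal.rpow_le_rpow (h f hf) (by positivity)).trans (le_of_eq ?_)
      rw [ENNReal.mul_rpow_of_nonneg _ _ (by positivity), ← ENNReal.rpow_mul]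
      congr 2
      field_simp

lemma cMax_split {X : Type*} [MetricSpace X] [MeasurableSpace X]
    (μ : Measure X) (f f0 f1 : X → ℝ) (h0 : Measurable f0)
    (h : ∀ x, 2 * |f x| ≤ |f0 x| + |f1 x|) (x : X) :
    cMax μ f x ≤ max (cMax μ f0 x) (cMax μ f1 x) := by
  refine iSup_le fun s => iSup_le fun hs => iSup_le fun hp => iSup_le fun ht => ?_
  set m := (μ (Metric.ball x s))⁻¹
  have hle : ∀ g : X → ℝ, m * ∫⁻ y in Metric.ball x s, ENNReal.ofReal |g y| ∂μ ≤ cMax μ g x := by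
    intro g
    unfold cMax
    exact le_iSup_of_le s (le_iSup_of_le hs (le_iSup_of_le hp (le_iSup_of_le ht le_rfl)))
  have h2 : 2 * (m * ∫⁻ y in Metric.ball x s, ENNReal.ofReal |f y| ∂μ) ≤
      2 * max (cMax μ f0 x) (cMax μ f1 x) := by
    calc _ = m * ∫⁻ y in Metric.ball x s, 2 * ENNReal.ofReal |f y| ∂μ := by
          rw [lintegral_const_mul' _ _ (by simp)]; ring
      _ ≤ m * ∫⁻ y in Metric.ball x s, (ENNReal.ofReal |f0 y| + ENNReal.ofReal |f1 y|) ∂μ := by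
          gcongr with y
          rw [← ENNReal.ofReal_add (abs_nonneg _) (abs_nonneg _), ← ENNReal.ofReal_ofNat 2,
            ← ENNReal.ofReal_mul (by norm_num)]
          exact ENNReal.ofReal_le_ofReal (h y)
      _ = m * ∫⁻ y in Metric.ball x s, ENNReal.ofReal |f0 y| ∂μ +
          m * ∫⁻ y in Metric.ball x s, ENNReal.ofReal |f1 y| ∂μ := by
          rw [lintegral_add_left (by fun_prop), mul_add]
      _ ≤ max (cMax μ f0 x) (cMax μ f1 x) + max (cMax μ f0 x) (cMax μ f1 x) :=
          add_le_add ((hle f0).trans (le_max_left _ _)) ((hle f1).trans (le_max_right _ _))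
      _ = _ := by ring
  exact (ENNReal.mul_le_mul_iff_right (by simp) (by simp)).1 h2

lemma psi_split {X : Type*} [MeasurableSpace X]
    (μ : Measure X) (p : ℝ) (hp : 1 < p) (g g0 g1 : X → ℝ≥0∞)
    (h : ∀ x, g x ≤ max (g0 x) (g1 x)) (t : ℝ) :
    psiL μ p g t ≤ psiL μ p g0 t + psiL μ p g1 t := by
  unfold psiL
  rw [← mul_add]
  refine mul_le_mul' le_rfl ?_
  refine le_trans ?_ (ENNReal.rpow_add_le_add_rpow _ _ (by positivity) ?_)
  · refine ENNReal.rpow_le_rpow ((measure_mono ?_).trans (measure_union_le _ _)) (by positivity)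
    intro x hx
    exact lt_max_iff.1 (lt_of_lt_of_le hx (h x))
  · rw [div_le_one (by linarith)]; exact hp.le

lemma weak_split {X : Type*} [MetricSpace X] [MeasurableSpace X]
    (μ : Measure X) (p : ℝ) (hp : 1 < p) (f : X → ℝ) (hf : Measurable f)
    (A : Set ℝ) (hA : MeasurableSet A) (s : ℝ) :
    nuL {t | ENNReal.ofReal s < 2⁻¹ * psiL μ p (cMax μ f) t} ≤
      nuL {t | ENNReal.ofReal s < psiL μ p (cMax μ fun x => phiL A (|f x|)) t} +
      nuL {t | ENNReal.ofReal s < psiL μ p (cMax μ fun x => phiL Aᶜ (|f x|)) t} := by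
  refine (measure_mono ?_).trans (measure_union_le _ _)
  intro t ht
  have h1 := psi_split μ p hp (cMax μ f) (cMax μ fun x => phiL A (|f x|))
    (cMax μ fun x => phiL Aᶜ (|f x|)) (cMax_split μ f _ _
      ((phiL_mono A).measurable.comp (by fun_prop)) fun x => by
        rw [abs_of_nonneg (phiL_nonneg _ _), abs_of_nonneg (phiL_nonneg _ _),
          phiL_add A hA _ (abs_nonneg _)]) t
  by_contra hcon
  simp only [Set.mem_union, Set.mem_ofPred_eq, not_or, not_lt] at hcon ht
  have h2 : 2⁻¹ * psiL μ p (cMax μ f) t ≤ ENNReal.ofReal s := by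
    calc _ ≤ 2⁻¹ * (ENNReal.ofReal s + ENNReal.ofReal s) := by
          gcongr 2⁻¹ * ?_
          exact h1.trans (add_le_add hcon.1 hcon.2)
      _ = _ := by rw [← two_mul, ← mul_assoc, ENNReal.inv_mul_cancel (by simp) (by simp), one_mul]
  exact absurd ht (not_lt.2 h2)

lemma cheb (ν : Measure ℝ) (u : ℝ → ℝ≥0∞) (hu : Measurable u) (s r : ℝ) (hs : 0 < s) (hr : 0 < r) :
    ν {t | ENNReal.ofReal s < u t} ≤ ENNReal.ofReal (s ^ (-r)) * ∫⁻ t, u t ^ r ∂ν := by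
  have h1 := mul_meas_ge_le_lintegral (μ := ν) (hu.pow_const r) (ENNReal.ofReal (s ^ r))
  calc _ ≤ ν {t | ENNReal.ofReal (s ^ r) ≤ u t ^ r} := by
        apply measure_mono
        intro t ht
        rw [Set.mem_ofPred_eq] at ht ⊢
        rw [← ENNReal.ofReal_rpow_of_pos hs]
        exact ENNReal.rpow_le_rpow ht.le hr.le
    _ = ENNReal.ofReal (s ^ (-r)) * (ENNReal.ofReal (s ^ r) *
          ν {t | ENNReal.ofReal (s ^ r) ≤ u t ^ r}) := by
        rw [← mul_assoc, ← ENNReal.ofReal_mul (by positivity), ← Real.rpow_add hs]; simp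
    _ ≤ _ := by gcongr

lemma part_weak {X : Type*} [MetricSpace X] [MeasurableSpace X]
    (μ : Measure X) (p : ℝ) (hp : 1 < p) (q0 r0 : ℝ) (hq0 : 1 ≤ q0) (hr0 : 1 ≤ r0) (K : ℝ≥0∞)
    (hK : ∀ f : X → ℝ, Measurable f → ∫⁻ t, psiL μ p (cMax μ f) t ^ r0 ∂nuL ≤
        K * (∫⁻ t, psiL μ p (fun x => ENNReal.ofReal |f x|) t ^ q0 ∂nuL) ^ (r0 / q0))
    (f : X → ℝ) (hf : Measurable f) (A : Set ℝ) (hA : MeasurableSet A) (s : ℝ) (hs : 0 < s) :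
    nuL {t | ENNReal.ofReal s < psiL μ p (cMax μ fun x => phiL A (|f x|)) t} ≤
      ENNReal.ofReal (s ^ (-r0)) * ((K * ENNReal.ofReal (2 ^ q0) ^ (r0 / q0)) *
      (∫⁻ t, A.indicator (fun t => psiL μ p (fun x => ENNReal.ofReal |f x|) t ^ q0) t ∂nuL)
        ^ (r0 / q0)) := by
  refine (cheb nuL _ (psiL_meas _ _ _) s r0 hs (by linarith)).trans ?_
  refine mul_le_mul' le_rfl ?_
  refine (hK _ ((phiL_mono A).measurable.comp (by fun_prop))).trans ?_
  rw [mul_assoc, ← ENNReal.mul_rpow_of_nonneg _ _ (by positivity)]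
  refine mul_le_mul' le_rfl (ENNReal.rpow_le_rpow ?_ (by positivity))
  exact psi_trunc μ p hp q0 hq0 f A hA

lemma X0 (a : ℝ → ℝ≥0∞) (ha : Measurable a)
    (q q0 r r0 γ c0 B : ℝ) (hq0 : 0 < q0) (hq : q0 < q) (hqr : q0 ≤ r0)
    (hγ : 0 < γ) (hγe : γ * (q - q0) = (r - r0) * (q0 / r0)) (hc : 0 < c0) (hB : 0 < B)
    (hI : ∫⁻ t, a t ^ q ∂nuL = ENNReal.ofReal B) (hr : r0 < r) (K : ℝ≥0∞) (hKt : K ≠ ⊤) :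
    ∫⁻ s in Set.Ioi (0 : ℝ), ENNReal.ofReal (s ^ (r - 1)) * (ENNReal.ofReal (s ^ (-r0)) * (K *
      (∫⁻ t, {t | ENNReal.ofReal (c0 * B ^ ((1 - γ) / q) * s ^ γ) < a t}.indicator
        (fun t => a t ^ q0) t ∂nuL) ^ (r0 / q0))) ≤
    K * ENNReal.ofReal ((γ * (q - q0))⁻¹ * c0 ^ (-((q - q0) * (r0 / q0)))) *
      ENNReal.ofReal B ^ (r / q) := by
  have hr0 : 0 < r0 := by linarith
  have hqp : 0 < q := by linarith
  have h := interp0 nuL a ha q q0 r r0 γ (c0 * B ^ ((1 - γ) / q)) hq0 hq hqr hr hγ hγe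
    (by positivity)
  calc _ = ∫⁻ s in Set.Ioi (0 : ℝ), K * (ENNReal.ofReal (s ^ (r - 1 - r0)) *
      (∫⁻ t, (if ENNReal.ofReal ((c0 * B ^ ((1 - γ) / q)) * s ^ γ) < a t then a t ^ q0 else 0)
        ∂nuL) ^ (r0 / q0)) := by
        refine setLIntegral_congr_fun measurableSet_Ioi fun s hs => ?_
        have hs : 0 < s := hs
        simp only [Set.indicator, Set.mem_ofPred_eq]
        rw [sub_eq_add_neg _ r0, Real.rpow_add hs, ENNReal.ofReal_mul (Real.rpow_nonneg hs.le _)]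
        generalize (∫⁻ t, (if ENNReal.ofReal ((c0 * B ^ ((1 - γ) / q)) * s ^ γ) < a t
          then a t ^ q0 else 0) ∂nuL) = J
        ring
    _ ≤ _ := by
        rw [lintegral_const_mul' _ _ hKt, mul_assoc]
        refine mul_le_mul' le_rfl (h.trans (le_of_eq ?_))
        rw [hI, ENNReal.ofReal_rpow_of_pos hB, ENNReal.ofReal_rpow_of_pos hB,
          ← ENNReal.ofReal_mul (by have := sub_pos.2 hq; positivity),
          ← ENNReal.ofReal_mul (by have := sub_pos.2 hq; positivity),
          Real.mul_rpow hc.le (by positivity), ← Real.rpow_mul hB.le]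
        have : r / q = (1 - γ) / q * -((q - q0) * (r0 / q0)) + r0 / q0 := by
          have h2 : γ * (q - q0) * (r0 / q0) = r - r0 := by rw [hγe]; field_simp
          have h3 : (1 - γ) / q * -((q - q0) * (r0 / q0)) =
            (γ * (q - q0) * (r0 / q0) - (q - q0) * (r0 / q0)) / q := by ring
          rw [h3, h2]; field_simp; ring
        rw [this, Real.rpow_add hB]
        congr 1
        ring

lemma X1 (a : ℝ → ℝ≥0∞) (ha : Measurable a)
    (q q1 r r1 γ c0 B : ℝ) (hq0 : 0 < q) (hq : q < q1) (hqr : q1 ≤ r1)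
    (hγ : 0 < γ) (hγe : γ * (q1 - q) = (r1 - r) * (q1 / r1)) (hc : 0 < c0) (hB : 0 < B)
    (hI : ∫⁻ t, a t ^ q ∂nuL = ENNReal.ofReal B) (hr : r < r1) (K : ℝ≥0∞) (hKt : K ≠ ⊤) :
    ∫⁻ s in Set.Ioi (0 : ℝ), ENNReal.ofReal (s ^ (r - 1)) * (ENNReal.ofReal (s ^ (-r1)) * (K *
      (∫⁻ t, {t | ENNReal.ofReal (c0 * B ^ ((1 - γ) / q) * s ^ γ) < a t}ᶜ.indicator
        (fun t => a t ^ q1) t ∂nuL) ^ (r1 / q1))) ≤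
    K * ENNReal.ofReal ((γ * (q1 - q))⁻¹ * c0 ^ (((q1 - q) * (r1 / q1)))) *
      ENNReal.ofReal B ^ (r / q) := by
  have hq1 : 0 < q1 := by linarith
  have hr0 : 0 < r1 := by linarith
  have h := interp1 nuL a ha q q1 r r1 γ (c0 * B ^ ((1 - γ) / q)) hq0 hq hqr hr hγ hγe
    (by positivity)
  calc _ = ∫⁻ s in Set.Ioi (0 : ℝ), K * (ENNReal.ofReal (s ^ (r - 1 - r1)) *
      (∫⁻ t, (if ENNReal.ofReal ((c0 * B ^ ((1 - γ) / q)) * s ^ γ) < a t then 0 else a t ^ q1)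
        ∂nuL) ^ (r1 / q1)) := by
        refine setLIntegral_congr_fun measurableSet_Ioi fun s hs => ?_
        have hs : 0 < s := hs
        simp only [Set.indicator, Set.mem_ofPred_eq, Set.mem_compl_iff, ite_not]
        rw [sub_eq_add_neg _ r1, Real.rpow_add hs, ENNReal.ofReal_mul (Real.rpow_nonneg hs.le _)]
        generalize (∫⁻ t, (if ENNReal.ofReal ((c0 * B ^ ((1 - γ) / q)) * s ^ γ) < a t
          then 0 else a t ^ q1) ∂nuL) = J
        ring
    _ ≤ _ := by
        rw [lintegral_const_mul' _ _ hKt, mul_assoc]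
        refine mul_le_mul' le_rfl (h.trans (le_of_eq ?_))
        rw [hI, ENNReal.ofReal_rpow_of_pos hB, ENNReal.ofReal_rpow_of_pos hB,
          ← ENNReal.ofReal_mul (by have := sub_pos.2 hq; positivity),
          ← ENNReal.ofReal_mul (by have := sub_pos.2 hq; positivity),
          Real.mul_rpow hc.le (by positivity), ← Real.rpow_mul hB.le]
        have : r / q = (1 - γ) / q * ((q1 - q) * (r1 / q1)) + r1 / q1 := by
          have h2 : γ * (q1 - q) * (r1 / q1) = r1 - r := by rw [hγe]; field_simp
          have h3 : (1 - γ) / q * ((q1 - q) * (r1 / q1)) =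
            ((q1 - q) * (r1 / q1) - γ * (q1 - q) * (r1 / q1)) / q := by ring
          rw [h3, h2]; field_simp; ring
        rw [this, Real.rpow_add hB]
        congr 1
        ring

lemma final_layer {X : Type*} [MetricSpace X] [MeasurableSpace X]
    (μ : Measure X) (p : ℝ) (r : ℝ) (hr : 0 < r) (f : X → ℝ) (R : ℝ≥0∞)
    (h : ∫⁻ s in Set.Ioi (0 : ℝ), ENNReal.ofReal (s ^ (r - 1)) *
      nuL {t | ENNReal.ofReal s < 2⁻¹ * psiL μ p (cMax μ f) t} ≤ R) :
    ∫⁻ t, psiL μ p (cMax μ f) t ^ r ∂nuL ≤ ENNReal.ofReal (2 ^ r * r) * R := by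
  rw [← layer nuL r hr _ ((psiL_meas _ _ _).const_mul _)] at h
  simp_rw [ENNReal.mul_rpow_of_nonneg _ _ hr.le] at h
  rw [lintegral_const_mul _ ((psiL_meas _ _ _).pow_const _)] at h
  refine le_trans (le_of_eq ?_) (mul_le_mul' le_rfl h)
  have : (2⁻¹ : ℝ≥0∞) = ENNReal.ofReal 2⁻¹ := by
    rw [ENNReal.ofReal_inv_of_pos (by norm_num)]; simp
  rw [this, ENNReal.ofReal_rpow_of_pos (by norm_num), ← mul_assoc, ← mul_assoc,
    ← ENNReal.ofReal_mul (by positivity), ← ENNReal.ofReal_mul (by positivity),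
    Real.inv_rpow (by norm_num)]
  have : (2 : ℝ) ^ r * r * r⁻¹ * (2 ^ r)⁻¹ = 1 := by
    have : (0 : ℝ) < 2 ^ r := by positivity
    field_simp
  rw [this]; simp

/-- reduction to functions of finite nonzero norm -/
lemma reduce {X : Type*} [MetricSpace X] [MeasurableSpace X]
    (μ : Measure X) (p : ℝ) (q r q0 r0 : ℝ) (hq : 0 < q) (hr : 0 < r) (hq0 : 0 < q0)
    (hr0 : 0 < r0) (K0 K : ℝ≥0∞) (hKt : K ≠ ⊤)
    (hK0 : ∀ f : X → ℝ, Measurable f → ∫⁻ t, psiL μ p (cMax μ f) t ^ r0 ∂nuL ≤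
        K0 * (∫⁻ t, psiL μ p (fun x => ENNReal.ofReal |f x|) t ^ q0 ∂nuL) ^ (r0 / q0))
    (hK : ∀ f : X → ℝ, Measurable f → ∀ B : ℝ, 0 < B →
      ∫⁻ t, psiL μ p (fun x => ENNReal.ofReal |f x|) t ^ q ∂nuL = ENNReal.ofReal B →
      ∫⁻ t, psiL μ p (cMax μ f) t ^ r ∂nuL ≤ K * ENNReal.ofReal B ^ (r / q)) :
    ∃ K : ℝ≥0∞, K ≠ ⊤ ∧ ∀ f : X → ℝ, Measurable f →
      ∫⁻ t, psiL μ p (cMax μ f) t ^ r ∂nuL ≤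
        K * (∫⁻ t, psiL μ p (fun x => ENNReal.ofReal |f x|) t ^ q ∂nuL) ^ (r / q) := by
  refine ⟨K + 1, by simp [hKt], fun f hf => ?_⟩
  set I := ∫⁻ t, psiL μ p (fun x => ENNReal.ofReal |f x|) t ^ q ∂nuL with hI
  rcases eq_or_ne I ⊤ with h | h
  · rw [h, ENNReal.top_rpow_of_pos (by positivity), ENNReal.mul_top (by simp)]
    exact le_top
  rcases eq_or_ne I 0 with h0 | h0
  · have h1 : ∫⁻ t, psiL μ p (fun x => ENNReal.ofReal |f x|) t ^ q0 ∂nuL = 0 := by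
      rw [hI, lintegral_eq_zero_iff ((psiL_meas _ _ _).pow_const _)] at h0
      rw [lintegral_eq_zero_iff ((psiL_meas _ _ _).pow_const _)]
      filter_upwards [h0] with t ht
      have ht' : psiL μ p (fun x => ENNReal.ofReal |f x|) t = 0 := by
        simpa [ENNReal.rpow_eq_zero_iff, hq, hq.le, not_lt.2 hq.le] using ht
      simp [ht', hq0]
    have h2 := hK0 f hf
    rw [h1, ENNReal.zero_rpow_of_pos (by positivity), mul_zero, nonpos_iff_eq_zero,
      lintegral_eq_zero_iff ((psiL_meas _ _ _).pow_const _)] at h2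
    have h3 : ∫⁻ t, psiL μ p (cMax μ f) t ^ r ∂nuL = 0 := by
      rw [lintegral_eq_zero_iff ((psiL_meas _ _ _).pow_const _)]
      filter_upwards [h2] with t ht
      have ht' : psiL μ p (cMax μ f) t = 0 := by
        simpa [ENNReal.rpow_eq_zero_iff, hr0, hr0.le, not_lt.2 hr0.le] using ht
      simp [ht', hr]
    rw [h3]; exact zero_le
  · have h1 : I = ENNReal.ofReal I.toReal := (ENNReal.ofReal_toReal h).symm
    have := hK f hf I.toReal (ENNReal.toReal_pos h0 h) h1
    rw [← h1] at this
    refine this.trans (mul_le_mul' ?_ le_rfl)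
    simp

lemma X0_meas (a : ℝ → ℝ≥0∞) (ha : Measurable a) (q0 r r0 γ c ρ : ℝ) (K : ℝ≥0∞) :
    Measurable fun s : ℝ => ENNReal.ofReal (s ^ (r - 1)) * (ENNReal.ofReal (s ^ (-r0)) * (K *
      (∫⁻ t, {t | ENNReal.ofReal (c * s ^ γ) < a t}.indicator
        (fun t => a t ^ q0) t ∂nuL) ^ ρ)) := by
  have hm : Measurable (Function.uncurry fun (s t : ℝ) =>
      (if ENNReal.ofReal (c * s ^ γ) < a t then a t ^ q0 else 0)) := by
    apply Measurable.ite
    · exact measurableSet_lt (by fun_prop) (by fun_prop)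
    · fun_prop
    · fun_prop
  have h2 : Measurable fun s : ℝ => ∫⁻ t, {t | ENNReal.ofReal (c * s ^ γ) < a t}.indicator
        (fun t => a t ^ q0) t ∂nuL := by
    simp only [Set.indicator, Set.mem_ofPred_eq]
    exact hm.lintegral_prod_right'
  fun_prop

lemma main_fin {X : Type*} [MetricSpace X] [MeasurableSpace X]
    (μ : Measure X) (p : ℝ) (hp : 1 < p) (q r q0 r0 q1 r1 γ : ℝ) (hq0 : 1 ≤ q0) (hq0q : q0 < q)
    (hqq1 : q < q1) (hr0r : r0 < r) (hrr1 : r < r1) (hqr0 : q0 ≤ r0) (hqr1 : q1 ≤ r1)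
    (hγ : 0 < γ) (hγ0 : γ * (q - q0) = (r - r0) * (q0 / r0))
    (hγ1 : γ * (q1 - q) = (r1 - r) * (q1 / r1))
    (K0 K1 : ℝ≥0∞) (hK0t : K0 ≠ ⊤) (hK1t : K1 ≠ ⊤)
    (hK0 : ∀ f : X → ℝ, Measurable f → ∫⁻ t, psiL μ p (cMax μ f) t ^ r0 ∂nuL ≤
        K0 * (∫⁻ t, psiL μ p (fun x => ENNReal.ofReal |f x|) t ^ q0 ∂nuL) ^ (r0 / q0))
    (hK1 : ∀ f : X → ℝ, Measurable f → ∫⁻ t, psiL μ p (cMax μ f) t ^ r1 ∂nuL ≤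
        K1 * (∫⁻ t, psiL μ p (fun x => ENNReal.ofReal |f x|) t ^ q1 ∂nuL) ^ (r1 / q1)) :
    ∃ K : ℝ≥0∞, K ≠ ⊤ ∧ ∀ f : X → ℝ, Measurable f →
      ∫⁻ t, psiL μ p (cMax μ f) t ^ r ∂nuL ≤
        K * (∫⁻ t, psiL μ p (fun x => ENNReal.ofReal |f x|) t ^ q ∂nuL) ^ (r / q) := by
  set L0 := K0 * ENNReal.ofReal (2 ^ q0) ^ (r0 / q0) with hL0
  set L1 := K1 * ENNReal.ofReal (2 ^ q1) ^ (r1 / q1) with hL1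
  have hL0t : L0 ≠ ⊤ := ENNReal.mul_ne_top hK0t (p_pow_ne _ _ (by positivity)).2
  have hL1t : L1 ≠ ⊤ := ENNReal.mul_ne_top hK1t (p_pow_ne _ _ (by positivity)).2
  refine reduce μ p q r q0 r0 (by linarith) (by linarith) (by linarith) (by linarith) K0
    (ENNReal.ofReal (2 ^ r * r) *
      (L0 * ENNReal.ofReal ((γ * (q - q0))⁻¹ * 1 ^ (-((q - q0) * (r0 / q0)))) +
       L1 * ENNReal.ofReal ((γ * (q1 - q))⁻¹ * 1 ^ (((q1 - q) * (r1 / q1)))))) ?_ hK0 ?_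
  · refine ENNReal.mul_ne_top ENNReal.ofReal_ne_top (ENNReal.add_ne_top.2 ⟨?_, ?_⟩)
    · exact ENNReal.mul_ne_top hL0t ENNReal.ofReal_ne_top
    · exact ENNReal.mul_ne_top hL1t ENNReal.ofReal_ne_top
  intro f hf B hB hI
  rw [mul_assoc]
  refine final_layer μ p r (by linarith) f _ ?_
  have ha := psiL_meas μ p (fun x => ENNReal.ofReal |f x|)
  rw [add_mul]
  refine le_trans ?_ (add_le_add
    (X0 _ ha q q0 r r0 γ 1 B (by linarith) hq0q hqr0 hγ hγ0 one_pos hB hI hr0r L0 hL0t)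
    (X1 _ ha q q1 r r1 γ 1 B (by linarith) hqq1 hqr1 hγ hγ1 one_pos hB hI hrr1 L1 hL1t))
  rw [← lintegral_add_left (X0_meas _ ha _ _ _ _ _ _ _)]
  refine setLIntegral_mono' measurableSet_Ioi fun s hs => ?_
  have hs : 0 < s := hs
  rw [← mul_add]
  refine mul_le_mul' le_rfl ?_
  have hA : MeasurableSet {t | ENNReal.ofReal (1 * B ^ ((1 - γ) / q) * s ^ γ) <
    psiL μ p (fun x => ENNReal.ofReal |f x|) t} := measurableSet_lt measurable_const ha
  refine (weak_split μ p hp f hf _ hA s).trans (add_le_add ?_ ?_)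
  · exact part_weak μ p hp q0 r0 hq0 (by linarith) K0 hK0 f hf _ hA s hs
  · exact part_weak μ p hp q1 r1 (by linarith) (by linarith) K1 hK1 f hf _ hA.compl s hs

lemma main_top {X : Type*} [MetricSpace X] [MeasurableSpace X]
    (μ : Measure X) (p : ℝ) (hp : 1 < p) (q r q0 r0 x1 γ : ℝ) (hq0 : 1 ≤ q0) (hq0q : q0 < q)
    (hr0r : r0 < r) (hqr0 : q0 ≤ r0)
    (hγ : 0 < γ) (hγ0 : γ * (q - q0) = (r - r0) * (q0 / r0))
    (hγ1 : γ * (1 - q * x1) = 1)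
    (K0 : ℝ≥0∞) (hK0t : K0 ≠ ⊤) (D : ℝ) (hD : 0 < D)
    (hK0 : ∀ f : X → ℝ, Measurable f → ∫⁻ t, psiL μ p (cMax μ f) t ^ r0 ∂nuL ≤
        K0 * (∫⁻ t, psiL μ p (fun x => ENNReal.ofReal |f x|) t ^ q0 ∂nuL) ^ (r0 / q0))
    (hK1 : ∀ f : X → ℝ, Measurable f → ∀ l B : ℝ, 0 < l → 0 < B →
      ∫⁻ t, psiL μ p (fun x => ENNReal.ofReal |f x|) t ^ q ∂nuL = ENNReal.ofReal B →
      ∀ t, psiL μ p (cMax μ fun x => phiL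
        {t | ENNReal.ofReal l < psiL μ p (fun x => ENNReal.ofReal |f x|) t}ᶜ (|f x|)) t ≤
        ENNReal.ofReal (D * l ^ (1 - q * x1) * B ^ x1)) :
    ∃ K : ℝ≥0∞, K ≠ ⊤ ∧ ∀ f : X → ℝ, Measurable f →
      ∫⁻ t, psiL μ p (cMax μ f) t ^ r ∂nuL ≤
        K * (∫⁻ t, psiL μ p (fun x => ENNReal.ofReal |f x|) t ^ q ∂nuL) ^ (r / q) := by
  have hqp : 0 < q := by linarith
  set L0 := K0 * ENNReal.ofReal (2 ^ q0) ^ (r0 / q0) with hL0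
  have hL0t : L0 ≠ ⊤ := ENNReal.mul_ne_top hK0t (p_pow_ne _ _ (by positivity)).2
  set c0 : ℝ := D ^ (-γ) with hc0
  have hc0p : 0 < c0 := by positivity
  refine reduce μ p q r q0 r0 (by linarith) (by linarith) (by linarith) (by linarith) K0
    (ENNReal.ofReal (2 ^ r * r) *
      (L0 * ENNReal.ofReal ((γ * (q - q0))⁻¹ * c0 ^ (-((q - q0) * (r0 / q0)))))) ?_ hK0 ?_
  · refine ENNReal.mul_ne_top ENNReal.ofReal_ne_top ?_
    exact ENNReal.mul_ne_top hL0t ENNReal.ofReal_ne_top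
  intro f hf B hB hI
  rw [mul_assoc]
  refine final_layer μ p r (by linarith) f _ ?_
  have ha := psiL_meas μ p (fun x => ENNReal.ofReal |f x|)
  refine le_trans ?_
    (X0 _ ha q q0 r r0 γ c0 B (by linarith) hq0q hqr0 hγ hγ0 hc0p hB hI hr0r L0 hL0t)
  refine setLIntegral_mono' measurableSet_Ioi fun s hs => ?_
  have hs : 0 < s := hs
  refine mul_le_mul' le_rfl ?_
  have hA : MeasurableSet {t | ENNReal.ofReal (c0 * B ^ ((1 - γ) / q) * s ^ γ) <
    psiL μ p (fun x => ENNReal.ofReal |f x|) t} := measurableSet_lt measurable_const ha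
  refine (weak_split μ p hp f hf _ hA s).trans ?_
  have hz : D * (c0 * B ^ ((1 - γ) / q) * s ^ γ) ^ (1 - q * x1) * B ^ x1 = s := by
    rw [Real.mul_rpow (by positivity) (by positivity), Real.mul_rpow (by positivity) (by positivity),
      ← Real.rpow_mul hs.le, hγ1, Real.rpow_one, hc0, ← Real.rpow_mul hD.le, ← Real.rpow_mul hB.le,
      neg_mul, hγ1]
    have e : (1 - γ) / q * (1 - q * x1) = - x1 := by
      have : (1 - γ) / q * (1 - q * x1) = ((1 - q * x1) - γ * (1 - q * x1)) / q := by ring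
      rw [this, hγ1]; field_simp; ring
    rw [e, Real.rpow_neg hB.le, Real.rpow_neg hD.le, Real.rpow_one]
    have : 0 < B ^ x1 := by positivity
    field_simp
  have h1 := hK1 f hf (c0 * B ^ ((1 - γ) / q) * s ^ γ) B (by positivity) hB hI
  rw [hz] at h1
  have h2 : {t | ENNReal.ofReal s < psiL μ p (cMax μ fun x => phiL
        {t | ENNReal.ofReal (c0 * B ^ ((1 - γ) / q) * s ^ γ) <
          psiL μ p (fun x => ENNReal.ofReal |f x|) t}ᶜ (|f x|)) t} = ∅ :=
    Set.eq_empty_iff_forall_notMem.2 fun t ht => not_lt.2 (h1 t) ht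
  rw [h2, measure_empty, add_zero]
  exact part_weak μ p hp q0 r0 hq0 (by linarith) K0 hK0 f hf _ hA s hs


lemma low_int (a : ℝ → ℝ≥0∞) (ha : Measurable a) (q q1 l : ℝ) (hq0 : 0 < q) (hq : q < q1)
    (hl : 0 < l) :
    ∫⁻ t, {t | ENNReal.ofReal l < a t}ᶜ.indicator (fun t => a t ^ q1) t ∂nuL ≤
      ENNReal.ofReal (l ^ (q1 - q)) * ∫⁻ t, a t ^ q ∂nuL := by
  rw [← lintegral_const_mul _ (ha.pow_const _)]
  refine lintegral_mono fun t => ?_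
  simp only [Set.indicator, Set.mem_ofPred_eq, Set.mem_compl_iff, ite_not]
  split_ifs with h
  · exact zero_le
  · have e1 : a t ^ q1 = a t ^ (q1 - q) * a t ^ q := by
      rw [← ENNReal.rpow_add_of_nonneg _ _ (by linarith) hq0.le]; congr 1; ring
    rw [e1, ← ENNReal.ofReal_rpow_of_pos hl]
    refine mul_le_mul' (ENNReal.rpow_le_rpow (not_lt.1 h) (by linarith)) le_rfl

lemma top_ctrl {X : Type*} [MetricSpace X] [MeasurableSpace X]
    (μ : Measure X) (p : ℝ) (hp : 1 < p) (q1 : ℝ≥0∞) (hq1 : 1 ≤ q1) (q : ℝ) (hq : 1 ≤ q)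
    (hqq : ENNReal.ofReal q < q1) (h1 : BddMax μ p q1 ⊤) :
    ∃ D : ℝ, 0 < D ∧ ∀ f : X → ℝ, Measurable f → ∀ l B : ℝ, 0 < l → 0 < B →
      ∫⁻ t, psiL μ p (fun x => ENNReal.ofReal |f x|) t ^ q ∂nuL = ENNReal.ofReal B →
      ∀ t, psiL μ p (cMax μ fun x => phiL
        {t | ENNReal.ofReal l < psiL μ p (fun x => ENNReal.ofReal |f x|) t}ᶜ (|f x|)) t ≤
        ENNReal.ofReal (D * l ^ (1 - q * (q1⁻¹).toReal) * B ^ (q1⁻¹).toReal) := by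
  obtain ⟨C, hC, h⟩ := h1
  suffices hs : ∃ E : ℝ≥0∞, E ≠ ⊤ ∧ ∀ f : X → ℝ, Measurable f → ∀ l B : ℝ, 0 < l → 0 < B →
      ∫⁻ t, psiL μ p (fun x => ENNReal.ofReal |f x|) t ^ q ∂nuL = ENNReal.ofReal B →
      lNormE μ p q1 (fun x => ENNReal.ofReal |phiL
        {t | ENNReal.ofReal l < psiL μ p (fun x => ENNReal.ofReal |f x|) t}ᶜ (|f x|)|) ≤
        E * ENNReal.ofReal (l ^ (1 - q * (q1⁻¹).toReal) * B ^ (q1⁻¹).toReal) by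
    obtain ⟨E, hE, hs⟩ := hs
    refine ⟨(C * E).toReal + 1, by positivity, fun f hf l B hl hB hI t => ?_⟩
    rcases le_or_gt t 0 with ht | ht
    · simp [psiL, ENNReal.ofReal_of_nonpos ht]
    have h2 := h _ ((phiL_mono {t | ENNReal.ofReal l <
      psiL μ p (fun x => ENNReal.ofReal |f x|) t}ᶜ).measurable.comp (hf.abs))
    rw [lNormE_top] at h2
    refine (le_iSup₂ (f := fun (t : ℝ) (_ : 0 < t) => psiL μ p (cMax μ fun x => phiL
        {t | ENNReal.ofReal l < psiL μ p (fun x => ENNReal.ofReal |f x|) t}ᶜ (|f x|)) t) t ht).trans ?_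
    refine le_trans h2 ?_
    refine (mul_le_mul' le_rfl (hs f hf l B hl hB hI)).trans ?_
    have h3 : C * E ≤ ENNReal.ofReal ((C * E).toReal + 1) := by
      refine le_trans (ENNReal.ofReal_toReal (ENNReal.mul_ne_top hC.ne hE)).ge ?_
      exact ENNReal.ofReal_le_ofReal (by linarith)
    have h4 := mul_le_mul' h3 (le_refl
      (ENNReal.ofReal (l ^ (1 - q * (q1⁻¹).toReal) * B ^ (q1⁻¹).toReal)))
    rw [← ENNReal.ofReal_mul (by positivity), mul_assoc C] at h4
    rw [mul_assoc ((C * E).toReal + 1)]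
    exact h4
  rcases eq_or_ne q1 ⊤ with rfl | ht
  · refine ⟨4, by simp, fun f hf l B hl hB hI => ?_⟩
    rw [lNormE_top]
    refine iSup₂_le fun t ht => ?_
    have := psi_trunc_top μ p hp f
      {t | ENNReal.ofReal l < psiL μ p (fun x => ENNReal.ofReal |f x|) t}ᶜ (ENNReal.ofReal l)
      (fun t ht _ => le_of_not_gt ht) t ht
    simpa using this
  · have hy : 1 ≤ q1.toReal := toReal_pos' _ hq1 ht
    have hqy : q < q1.toReal := (ENNReal.ofReal_lt_iff_lt_toReal (by linarith) ht).1 hqq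
    refine ⟨ENNReal.ofReal p ^ (1 / q1.toReal) * 2, ENNReal.mul_ne_top
      (p_pow_ne _ _ (by linarith)).2 (by simp), fun f hf l B hl hB hI => ?_⟩
    rw [lNormE_fin _ _ _ ht, ENNReal.toReal_inv, mul_assoc]
    set y := q1.toReal
    have ha := psiL_meas μ p (fun x => ENNReal.ofReal |f x|)
    have hA : MeasurableSet {t | ENNReal.ofReal l <
      psiL μ p (fun x => ENNReal.ofReal |f x|) t} := measurableSet_lt measurable_const ha
    refine mul_le_mul' le_rfl ?_
    refine (ENNReal.rpow_le_rpow ((psi_trunc μ p hp y hy f _ hA.compl).trans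
      (mul_le_mul' le_rfl (low_int _ ha q y l (by linarith) hqy hl))) (by positivity)).trans
      (le_of_eq ?_)
    rw [hI, ← ENNReal.ofReal_mul (by positivity), ← ENNReal.ofReal_mul (by positivity),
      ENNReal.ofReal_rpow_of_pos (by positivity), ← ENNReal.ofReal_ofNat 2,
      ← ENNReal.ofReal_mul (by positivity),
      Real.mul_rpow (by positivity) (by positivity), Real.mul_rpow (by positivity) (by positivity),
      ← Real.rpow_mul (by positivity), ← Real.rpow_mul (by positivity)]
    have e1 : y * (1 / y) = 1 := by field_simp
    have e2 : (y - q) * (1 / y) = 1 - q * y⁻¹ := by field_simp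
    rw [e1, e2, Real.rpow_one, one_div]

theorem stmt_17 {X : Type*} [MetricSpace X] [MeasurableSpace X]
    (μ : Measure X) (p : ℝ) (hp : 1 < p)
    (q₀ q₁ r₀ r₁ : ℝ≥0∞) (hq₀ : 1 ≤ q₀) (hq₁ : 1 ≤ q₁) (hr₀ : 1 ≤ r₀) (hr₁ : 1 ≤ r₁)
    (hq01 : q₀ ≤ q₁) (hq0r0 : q₀ ≤ r₀) (hq1r1 : q₁ ≤ r₁)
    (θ : ℝ) (hθ0 : 0 < θ) (hθ1 : θ < 1)
    (qθ rθ : ℝ≥0∞)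
    (hqθ : qθ⁻¹ = ENNReal.ofReal (1 - θ) * q₀⁻¹ + ENNReal.ofReal θ * q₁⁻¹)
    (hrθ : rθ⁻¹ = ENNReal.ofReal (1 - θ) * r₀⁻¹ + ENNReal.ofReal θ * r₁⁻¹)
    (h0 : BddMax μ p q₀ r₀) (h1 : BddMax μ p q₁ r₁) :
    BddMax μ p qθ rθ := by
  have hp0 : 0 < p := by linarith
  have hsum : ENNReal.ofReal (1 - θ) + ENNReal.ofReal θ = 1 := by
    rw [← ENNReal.ofReal_add (by linarith) hθ0.le]; simp
  -- convexity bounds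
  have conv : ∀ a b m c : ℝ≥0∞, c⁻¹ = ENNReal.ofReal (1 - θ) * a⁻¹ + ENNReal.ofReal θ * b⁻¹ →
      m ≤ a → m ≤ b → m ≤ c := by
    intro a b m c hc ha hb
    rw [← ENNReal.inv_le_inv, hc]
    calc _ ≤ ENNReal.ofReal (1 - θ) * m⁻¹ + ENNReal.ofReal θ * m⁻¹ :=
          add_le_add (mul_le_mul' le_rfl (ENNReal.inv_le_inv.2 ha))
            (mul_le_mul' le_rfl (ENNReal.inv_le_inv.2 hb))
      _ = m⁻¹ := by rw [← add_mul, hsum, one_mul]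
  have conv2 : ∀ a b m c : ℝ≥0∞, c⁻¹ = ENNReal.ofReal (1 - θ) * a⁻¹ + ENNReal.ofReal θ * b⁻¹ →
      a ≤ m → b ≤ m → c ≤ m := by
    intro a b m c hc ha hb
    rw [← ENNReal.inv_le_inv, hc]
    calc m⁻¹ = ENNReal.ofReal (1 - θ) * m⁻¹ + ENNReal.ofReal θ * m⁻¹ := by
          rw [← add_mul, hsum, one_mul]
      _ ≤ _ := add_le_add (mul_le_mul' le_rfl (ENNReal.inv_le_inv.2 ha))
            (mul_le_mul' le_rfl (ENNReal.inv_le_inv.2 hb))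
  have hq1' : 1 ≤ qθ := conv _ _ _ _ hqθ hq₀ hq₁
  have hr1' : 1 ≤ rθ := conv _ _ _ _ hrθ hr₀ hr₁
  -- embedding argument
  have emb : ∀ q r : ℝ≥0∞, 1 ≤ r → qθ ≤ q → r ≤ rθ → BddMax μ p q r → BddMax μ p qθ rθ := by
    rintro q r hr hq hrr ⟨C, hC, h⟩
    obtain ⟨K, hK, hn⟩ := nest μ p hp0 r rθ hr hrr
    obtain ⟨K', hK', hn'⟩ := nest μ p hp0 qθ q hq1' hq
    refine ⟨K * (C * K'), (ENNReal.mul_ne_top hK (ENNReal.mul_ne_top hC.ne hK')).lt_top,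
      fun f hf => ?_⟩
    rw [mul_assoc, mul_assoc]
    exact (hn _).trans (mul_le_mul' le_rfl ((h f hf).trans (mul_le_mul' le_rfl (hn' _))))
  rcases le_or_gt r₁ r₀ with hr | hr
  · exact emb q₁ r₁ hr₁ (conv2 _ _ _ _ hqθ hq01 le_rfl) (conv _ _ _ _ hrθ hr le_rfl) h1
  rcases hq01.eq_or_lt with hq | hq
  · exact emb q₀ r₀ hr₀ (conv2 _ _ _ _ hqθ le_rfl hq.ge) (conv _ _ _ _ hrθ le_rfl hr.le) h0
  have hq0t : q₀ ≠ ⊤ := hq.ne_top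
  have hr0t : r₀ ≠ ⊤ := hr.ne_top
  have hθ' : ENNReal.ofReal (1 - θ) ≠ 0 := by simpa using hθ1
  have fin : ∀ a b c : ℝ≥0∞, c⁻¹ = ENNReal.ofReal (1 - θ) * a⁻¹ + ENNReal.ofReal θ * b⁻¹ →
      a ≠ ⊤ → c ≠ ⊤ := by
    rintro a b c hc ha rfl
    rw [ENNReal.inv_top, eq_comm, add_eq_zero, mul_eq_zero] at hc
    rcases hc.1 with h | h
    · exact hθ' h
    · exact ha (ENNReal.inv_eq_zero.1 h)
  have hqt : qθ ≠ ⊤ := fin _ _ _ hqθ hq0t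
  have hrt : rθ ≠ ⊤ := fin _ _ _ hrθ hr0t
  have real : ∀ a b c : ℝ≥0∞, c⁻¹ = ENNReal.ofReal (1 - θ) * a⁻¹ + ENNReal.ofReal θ * b⁻¹ →
      1 ≤ a → 1 ≤ b →
      (c.toReal)⁻¹ = (1 - θ) * (a.toReal)⁻¹ + θ * (b⁻¹).toReal := by
    intro a b c hc ha hb
    have ha' : a⁻¹ ≠ ⊤ := ENNReal.inv_ne_top.2 (by intro h; simp [h] at ha)
    have hb' : b⁻¹ ≠ ⊤ := ENNReal.inv_ne_top.2 (by intro h; simp [h] at hb)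
    rw [← ENNReal.toReal_inv, hc, ENNReal.toReal_add (ENNReal.mul_ne_top (by simp) ha')
      (ENNReal.mul_ne_top (by simp) hb'), ENNReal.toReal_mul, ENNReal.toReal_mul,
      ENNReal.toReal_ofReal (by linarith), ENNReal.toReal_ofReal hθ0.le, ENNReal.toReal_inv a]
  have eq := real _ _ _ hqθ hq₀ hq₁
  have er := real _ _ _ hrθ hr₀ hr₁
  have xlt : ∀ a b : ℝ≥0∞, 1 ≤ a → a < b → (b⁻¹).toReal < (a.toReal)⁻¹ := by
    intro a b ha hab
    rw [← ENNReal.toReal_inv]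
    refine (ENNReal.toReal_lt_toReal (ENNReal.inv_ne_top.2 ?_) (ENNReal.inv_ne_top.2 ?_)).2
      (ENNReal.inv_lt_inv.2 hab)
    · rintro rfl; simp at hab
    · rintro rfl; simp at ha
  have xq := xlt _ _ hq₀ hq
  have xr := xlt _ _ hr₀ hr
  obtain ⟨K0, hK0t, hK0⟩ := (bdd_fin μ p hp0 q₀ r₀ hq₀ hr₀ hq0t hr0t).1 h0
  rw [bdd_fin μ p hp0 qθ rθ hq1' hr1' hqt hrt]
  have b0 := toReal_pos' _ hq₀ hq0t
  have b1 := toReal_pos' _ hr₀ hr0t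
  have b2 := toReal_pos' _ hq1' hqt
  have b3 := toReal_pos' _ hr1' hrt
  have b4 : q₀.toReal ≤ r₀.toReal := ENNReal.toReal_mono hr0t hq0r0
  set x := (q₁⁻¹).toReal with hx
  set y := (r₁⁻¹).toReal with hy
  have hqx : x < (qθ.toReal)⁻¹ := by rw [eq]; nlinarith
  have hqqt : ENNReal.ofReal qθ.toReal < q₁ := by
    rw [ENNReal.ofReal_toReal hqt, ← ENNReal.inv_lt_inv,
      ← ENNReal.toReal_lt_toReal (ENNReal.inv_ne_top.2 (by rintro rfl; simp at hq₁))
        (ENNReal.inv_ne_top.2 (by intro h; simp [h] at hq1')), ENNReal.toReal_inv qθ]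
    exact hqx
  set q := qθ.toReal
  set r := rθ.toReal
  set q0 := q₀.toReal
  set r0 := r₀.toReal
  have hqp : 0 < q := by linarith
  have hrp : 0 < r := by linarith
  have hq0p : 0 < q0 := by linarith
  have hr0p : 0 < r0 := by linarith
  have hq0q : q0 < q := by
    rw [← inv_lt_inv₀ hqp hq0p, eq]; nlinarith
  have hr0r : r0 < r := by
    rw [← inv_lt_inv₀ hrp hr0p, er]; nlinarith
  -- key identities
  have dq : q - q0 = q * q0 * (θ * (q0⁻¹ - x)) := by
    have : q - q0 = q * q0 * (q0⁻¹ - q⁻¹) := by field_simp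
    rw [this, eq]; ring
  have dr : r - r0 = r * r0 * (θ * (r0⁻¹ - y)) := by
    have : r - r0 = r * r0 * (r0⁻¹ - r⁻¹) := by field_simp
    rw [this, er]; ring
  have hu : 0 < q0⁻¹ - x := by linarith
  have hv : 0 < r0⁻¹ - y := by linarith
  set γ := r * (r0⁻¹ - y) / (q * (q0⁻¹ - x)) with hγd
  have hγ : 0 < γ := by positivity
  have hγ0 : γ * (q - q0) = (r - r0) * (q0 / r0) := by
    rw [dq, dr, hγd]
    generalize q0⁻¹ - x = u at hu ⊢
    generalize r0⁻¹ - y = v at hv ⊢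
    field_simp
  rcases eq_or_ne r₁ ⊤ with hr1 | hr1t
  · have hy0 : y = 0 := by rw [hy, hr1]; simp
    rw [hr1] at h1
    obtain ⟨D, hD, hK1⟩ := top_ctrl μ p hp q₁ hq₁ q b2 hqqt h1
    refine main_top μ p hp q r q0 r0 x γ b0 hq0q hr0r b4 hγ hγ0 ?_ K0 hK0t D hD hK0 hK1
    have e1 : 1 - q * x = q * ((1 - θ) * (q0⁻¹ - x)) := by
      have : 1 - q * x = q * (q⁻¹ - x) := by field_simp
      rw [this, eq]; ring
    have e2 : r * ((1 - θ) * r0⁻¹) = 1 := by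
      have : r * r⁻¹ = 1 := mul_inv_cancel₀ hrp.ne'
      rw [er, hy0] at this; linarith
    rw [e1, hγd, hy0]
    have : r * (r0⁻¹ - 0) / (q * (q0⁻¹ - x)) * (q * ((1 - θ) * (q0⁻¹ - x))) =
      r * ((1 - θ) * r0⁻¹) := by
        rw [sub_zero]
        generalize q0⁻¹ - x = u at hu ⊢
        field_simp
    rw [this, e2]
  · have hq1t : q₁ ≠ ⊤ := ne_top_of_le_ne_top hr1t hq1r1
    obtain ⟨K1, hK1t, hK1⟩ := (bdd_fin μ p hp0 q₁ r₁ hq₁ hr₁ hq1t hr1t).1 h1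
    have b5 := toReal_pos' _ hq₁ hq1t
    have b6 := toReal_pos' _ hr₁ hr1t
    have b7 : q₁.toReal ≤ r₁.toReal := ENNReal.toReal_mono hr1t hq1r1
    rw [ENNReal.toReal_inv] at hx hy
    set q1 := q₁.toReal
    set r1 := r₁.toReal
    have hq1p : 0 < q1 := by linarith
    have hr1p : 0 < r1 := by linarith
    have hqq1 : q < q1 := by
      rw [← inv_lt_inv₀ hq1p hqp, ← hx]; exact hqx
    have hrr1 : r < r1 := by
      rw [← inv_lt_inv₀ hr1p hrp, er, ← hy]; nlinarith
    have dq1 : q1 - q = q * q1 * ((1 - θ) * (q0⁻¹ - x)) := by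
      have : q1 - q = q * q1 * (q⁻¹ - q1⁻¹) := by field_simp
      rw [this, eq, ← hx]; ring
    have dr1 : r1 - r = r * r1 * ((1 - θ) * (r0⁻¹ - y)) := by
      have : r1 - r = r * r1 * (r⁻¹ - r1⁻¹) := by field_simp
      rw [this, er, ← hy]; ring
    refine main_fin μ p hp q r q0 r0 q1 r1 γ b0 hq0q hqq1 hr0r hrr1 b4 b7 hγ hγ0 ?_
      K0 K1 hK0t hK1t hK0 hK1
    rw [dq1, dr1, hγd]
    generalize q0⁻¹ - x = u at hu ⊢
    generalize r0⁻¹ - y = v at hv ⊢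
    field_simp
end
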